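/- arXiv:1008.4888 — 4 statements merged into one kernel-verified Lean document; each statement's English description precedes it below -/
import Mathlib

section
/- Let w : ℂ → ℂ be continuously differentiable (as a function of two real variables) with compact support, and define Tw(z) = −(1/π)·∫_ℂ w(ζ)/(ζ−z) dA(ζ). Then Tw is real-differentiable at every z ∈ ℂ and its Wirtinger derivative satisfies ∂(Tw)/∂z̄ (z) = w(z) for all z ∈ ℂ. -/
open MeasureTheory Metric Complex Filter

noncomputable section

/-- The oscillating phase `e_{λ,z₀}(z) = exp(λ(z−z₀)² − conj λ · (conj (z−z₀))²)`. -/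
def phase (lam z0 z : ℂ) : ℂ :=
  Complex.exp (lam * (z - z0) ^ 2 - (starRingEnd ℂ) lam * ((starRingEnd ℂ) (z - z0)) ^ 2)

/-- Wirtinger derivative `∂u/∂z̄ = (1/2)(∂u/∂x₁ + i ∂u/∂x₂)`. -/
def wbar (u : ℂ → ℂ) (z : ℂ) : ℂ :=
  (1 / 2 : ℂ) * (fderiv ℝ u z 1 + Complex.I * fderiv ℝ u z Complex.I)

/-- Wirtinger derivative `∂u/∂z = (1/2)(∂u/∂x₁ − i ∂u/∂x₂)`. -/
def wz (u : ℂ → ℂ) (z : ℂ) : ℂ :=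
  (1 / 2 : ℂ) * (fderiv ℝ u z 1 - Complex.I * fderiv ℝ u z Complex.I)

/-- Sup norm of `u` over a set `s`. -/
def supOn (s : Set ℂ) (u : ℂ → ℂ) : ℝ := ⨆ z ∈ s, ‖u z‖

/-- The `C¹_{z̄}(D̄)` norm, `D = B(0,R)`: `max(sup_{D̄}|u|, sup_{D̄}|∂u/∂z̄|)`. -/
def normC1 (R : ℝ) (u : ℂ → ℂ) : ℝ :=
  max (supOn (closedBall (0:ℂ) R) u) (supOn (closedBall (0:ℂ) R) (wbar u))

/-- The Bukhgeim-type Green's kernel `g_{z₀}(z,ζ,λ)` for `D = B(0,R)`. -/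
def gker (R : ℝ) (z0 lam z ζ : ℂ) : ℂ :=
  (Complex.exp (lam * (ζ - z0) ^ 2 - (starRingEnd ℂ) lam * ((starRingEnd ℂ) (ζ - z0)) ^ 2) /
      (4 * (Real.pi : ℂ) ^ 2)) *
    ∫ η in ball (0 : ℂ) R,
      Complex.exp (-(lam * (η - z0) ^ 2) + (starRingEnd ℂ) lam * ((starRingEnd ℂ) (η - z0)) ^ 2) /
        ((z - η) * ((starRingEnd ℂ) η - (starRingEnd ℂ) ζ))

/-- The operator `g_{z₀,λ} u (z) = ∫_D g_{z₀}(z,ζ,λ) u(ζ) dA(ζ)`. -/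
def gop (R : ℝ) (z0 lam : ℂ) (u : ℂ → ℂ) (z : ℂ) : ℂ :=
  ∫ ζ in ball (0 : ℂ) R, gker R z0 lam z ζ * u ζ

/-- `L^p` norm over `D = B(0,R)` with respect to the area measure. -/
def lpOn (R p : ℝ) (u : ℂ → ℂ) : ℝ :=
  (∫ z in ball (0:ℂ) R, ‖u z‖ ^ p) ^ (1 / p)

/-- The Cauchy transform `Tw(z) = −(1/π)·∫_ℂ w(ζ)/(ζ−z) dA(ζ)`. -/
def cauchyT (w : ℂ → ℂ) (z : ℂ) : ℂ :=
  -(1 / (Real.pi : ℂ)) * ∫ ζ : ℂ, w ζ / (ζ - z)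

open scoped Convolution

theorem locallyIntegrable_complex_inv : LocallyIntegrable (fun t : ℂ => t⁻¹) := by
  refine locallyIntegrable_of_norm_le_rpow (μ := volume) (C := 1) (α := 1)
    (by simp [Complex.finrank_real_complex]) (by simp [Complex.finrank_real_complex])
    (Eventually.of_forall fun x => ?_) measurable_inv.aestronglyMeasurable
  simp [Real.rpow_neg_one]

theorem cauchyT_eq_convolution (w : ℂ → ℂ) :
    cauchyT w = fun z => (1 / (Real.pi : ℂ)) *
      ((fun t : ℂ => t⁻¹) ⋆[ContinuousLinearMap.mul ℝ ℂ, volume] w) z := by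
  funext z
  rw [convolution_eq_swap, cauchyT, neg_mul, ← mul_neg, ← integral_neg]
  congr 2 with ζ
  rw [ContinuousLinearMap.mul_apply', ← neg_sub ζ z, inv_neg, div_eq_mul_inv]
  ring

theorem clm_apply_add_I_mul (L : ℂ →L[ℝ] ℂ) (u : ℂ) :
    L u + I * L (I * u) = (starRingEnd ℂ) u * (L 1 + I * L I) := by
  have h (x : ℂ) : L x = x.re * L 1 + x.im * L I := by
    conv_lhs => rw [show x = x.re • (1 : ℂ) + x.im • I by simp]
    rw [map_add, map_smul, map_smul, real_smul, real_smul]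
  have hc : (starRingEnd ℂ) u = u.re - u.im * I := by
    apply Complex.ext <;> simp
  rw [h u, h (I * u), hc]
  simp only [mul_re, mul_im, I_re, I_im, zero_mul, one_mul, zero_sub, zero_add, ofReal_neg]
  linear_combination (u.im * L I) * I_mul_I

/-- A continuous function on the plane which vanishes for large radius is integrable on the
polar coordinate strip. -/
theorem integrableOn_polarStrip {G : ℝ × ℝ → ℂ} (hG : Continuous G) {R : ℝ}
    (hR : ∀ p : ℝ × ℝ, R < p.1 → G p = 0) :
    IntegrableOn G (Set.Ioi (0 : ℝ) ×ˢ Set.Ioo (-Real.pi) Real.pi) (volume.prod volume) := by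
  have h : IntegrableOn G (Set.Icc 0 R ×ˢ Set.Icc (-Real.pi) Real.pi) (volume.prod volume) :=
    hG.continuousOn.integrableOn_compact (isCompact_Icc.prod isCompact_Icc)
  refine h.of_forall_sdiff_eq_zero (measurableSet_Ioi.prod measurableSet_Ioo) ?_
  rintro ⟨r, θ⟩ ⟨⟨h1, h2⟩, h3⟩
  refine hR _ (not_le.1 fun h4 => h3 ⟨⟨le_of_lt h1, h4⟩, Set.Ioo_subset_Icc_self h2⟩)

/-- The Cauchy–Pompeiu formula at the origin for compactly supported functions. -/
theorem integral_inv_mul_dbar_eq {v : ℂ → ℂ} (hv : ContDiff ℝ 1 v) (hs : HasCompactSupport v) :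
    ∫ t : ℂ, t⁻¹ * (fderiv ℝ v t 1 + I * fderiv ℝ v t I) = -(2 * Real.pi * v 0) := by
  obtain ⟨R, -, hR⟩ := hs.isCompact.isBounded.exists_pos_norm_lt
  have hu (θ : ℝ) : ‖exp (θ * I)‖ = 1 := norm_exp_ofReal_mul_I θ
  have hnorm (r θ : ℝ) (hr : R < r) : (r : ℂ) * exp (θ * I) ∉ tsupport v := fun hmem => by
    have := hR _ hmem
    rw [norm_mul, hu, norm_real, mul_one, Real.norm_eq_abs] at this
    linarith [le_abs_self r]
  have hv0 (r θ : ℝ) (hr : R < r) : v (r * exp (θ * I)) = 0 :=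
    image_eq_zero_of_notMem_tsupport (hnorm r θ hr)
  have hd0 (r θ : ℝ) (hr : R < r) : fderiv ℝ v (r * exp (θ * I)) = 0 :=
    image_eq_zero_of_notMem_tsupport fun h => hnorm r θ hr (tsupport_fderiv_subset ℝ h)
  have hdv (x : ℂ) : HasFDerivAt v (fderiv ℝ v x) x :=
    (hv.differentiable one_ne_zero x).hasFDerivAt
  have hcont := hv.continuous_fderiv one_ne_zero
  let G₁ : ℝ × ℝ → ℂ := fun p => fderiv ℝ v (p.1 * exp (p.2 * I)) (exp (p.2 * I))
  let G₂ : ℝ × ℝ → ℂ := fun p => fderiv ℝ v (p.1 * exp (p.2 * I)) (I * exp (p.2 * I))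
  have hG₁ : Continuous G₁ := (hcont.comp (by fun_prop)).clm_apply (by fun_prop)
  have hG₂ : Continuous G₂ := (hcont.comp (by fun_prop)).clm_apply (by fun_prop)
  have hi₁ := integrableOn_polarStrip hG₁ (R := R) fun p hp => by simp [G₁, hd0 _ _ hp]
  have hi₂ := integrableOn_polarStrip hG₂ (R := R) fun p hp => by simp [G₂, hd0 _ _ hp]
  have hrad (θ : ℝ) : ∫ r in Set.Ioi (0 : ℝ), G₁ (r, θ) = - v 0 := by
    have hderiv (r : ℝ) : HasDerivAt (fun r : ℝ => v (r * exp (θ * I))) (G₁ (r, θ)) r := by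
      have h1 : HasDerivAt (fun r : ℝ => (r : ℂ) * exp (θ * I)) (exp (θ * I)) r := by
        simpa using (Complex.ofRealCLM.hasDerivAt (x := r)).mul_const (exp (θ * I))
      exact (hdv _).comp_hasDerivAt r h1
    have hint : IntegrableOn (fun r => G₁ (r, θ)) (Set.Ioi 0) := by
      have h : IntegrableOn (fun r => G₁ (r, θ)) (Set.Icc 0 R) :=
        (hG₁.comp (by fun_prop : Continuous fun r : ℝ => (r, θ))).continuousOn.integrableOn_compact
          isCompact_Icc
      refine h.of_forall_sdiff_eq_zero measurableSet_Ioi fun r hr => ?_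
      have : R < r := not_le.1 fun h4 => hr.2 ⟨le_of_lt hr.1, h4⟩
      simp [G₁, hd0 _ _ this]
    have hlim : Tendsto (fun r : ℝ => v (r * exp (θ * I))) atTop (nhds 0) :=
      tendsto_const_nhds.congr' <| (eventually_gt_atTop R).mono fun r hr => (hv0 r θ hr).symm
    rw [integral_Ioi_of_hasDerivAt_of_tendsto' (fun r _ => hderiv r) hint hlim]
    simp
  have hang (r : ℝ) (hr : 0 < r) : ∫ θ in Set.Ioo (-Real.pi) Real.pi, G₂ (r, θ) = 0 := by
    have hderiv (θ : ℝ) : HasDerivAt (fun θ : ℝ => v (r * exp (θ * I))) (r • G₂ (r, θ)) θ := by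
      have h1 : HasDerivAt (fun θ : ℝ => (r : ℂ) * exp (θ * I)) (r • (I * exp (θ * I))) θ := by
        have h := (((Complex.ofRealCLM.hasDerivAt (x := θ)).mul_const I).cexp).const_mul (r : ℂ)
        refine h.congr_deriv ?_
        simp [mul_comm]
      have h2 := (hdv _).comp_hasDerivAt θ h1
      rwa [map_smul] at h2
    have hc : Continuous fun θ => r • G₂ (r, θ) :=
      (hG₂.comp (by fun_prop : Continuous fun θ : ℝ => (r, θ))).const_smul r
    have h := intervalIntegral.integral_eq_sub_of_hasDerivAt (a := -Real.pi) (b := Real.pi)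
      (fun θ _ => hderiv θ) (hc.intervalIntegrable _ _)
    rw [intervalIntegral.integral_smul,
      intervalIntegral.integral_of_le (by linarith [Real.pi_pos]), integral_Ioc_eq_integral_Ioo] at h
    have hz : r • ∫ θ in Set.Ioo (-Real.pi) Real.pi, G₂ (r, θ) = 0 := by
      rw [h]
      simp [exp_neg, exp_pi_mul_I]
    exact (smul_eq_zero.1 hz).resolve_left hr.ne'
  have hI₁ : ∫ p in Set.Ioi (0 : ℝ) ×ˢ Set.Ioo (-Real.pi) Real.pi, G₁ p ∂(volume.prod volume) =
      -(2 * Real.pi * v 0) := by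
    rw [← setIntegral_prod_swap, setIntegral_prod (fun p : ℝ × ℝ => G₁ p.swap) hi₁.swap]
    simp only [Prod.swap, hrad]
    rw [setIntegral_const]
    rw [Real.volume_real_Ioo_of_le (by linarith [Real.pi_pos]), real_smul]
    push_cast
    ring
  have hI₂ : ∫ p in Set.Ioi (0 : ℝ) ×ˢ Set.Ioo (-Real.pi) Real.pi, G₂ p ∂(volume.prod volume) =
      0 := by
    rw [setIntegral_prod _ hi₂]
    exact setIntegral_eq_zero_of_forall_eq_zero fun r hr => hang r hr
  rw [← Complex.integral_comp_polarCoord_symm]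
  calc
    _ = ∫ p in Set.Ioi (0 : ℝ) ×ˢ Set.Ioo (-Real.pi) Real.pi, (G₁ p + I * G₂ p)
          ∂(volume.prod volume) := by
      refine setIntegral_congr_fun (measurableSet_Ioi.prod measurableSet_Ioo) ?_
      rintro ⟨r, θ⟩ ⟨hr, -⟩
      have hr0 : (r : ℂ) ≠ 0 := ofReal_ne_zero.2 (ne_of_gt hr)
      have he : Complex.polarCoord.symm (r, θ) = r * exp (θ * I) := by
        simp [exp_mul_I]
      simp only [he, G₁, G₂, clm_apply_add_I_mul]
      rw [← inv_eq_conj (hu θ), real_smul, mul_inv]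
      field_simp
    _ = _ := by
      rw [integral_add hi₁ (hi₂.const_mul I), integral_const_mul, hI₁, hI₂, mul_zero, add_zero]

theorem statement8 (w : ℂ → ℂ) (hw : ContDiff ℝ 1 w) (hsupp : HasCompactSupport w) (z : ℂ) :
    DifferentiableAt ℝ (cauchyT w) z ∧ wbar (cauchyT w) z = w z := by
  have hloc := locallyIntegrable_complex_inv
  have hcont := hw.continuous_fderiv one_ne_zero
  have hd := (hsupp.hasFDerivAt_convolution_right (ContinuousLinearMap.mul ℝ ℂ) hloc hw z).const_mul
    (1 / (Real.pi : ℂ))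
  rw [← cauchyT_eq_convolution] at hd
  refine ⟨hd.differentiableAt, ?_⟩
  have hex (x : ℂ) : Integrable fun t : ℂ => t⁻¹ * fderiv ℝ w (z - t) x :=
    (hsupp.fderiv_apply ℝ x).convolutionExists_right (ContinuousLinearMap.mul ℝ ℂ) hloc
      (hcont.clm_apply continuous_const) z
  have hv : ContDiff ℝ 1 fun t => w (z - t) := hw.comp (contDiff_const.sub contDiff_id)
  have hvs : HasCompactSupport fun t => w (z - t) :=
    hsupp.comp_homeomorph (Homeomorph.subLeft z)
  have hfd (t : ℂ) : fderiv ℝ (fun t => w (z - t)) t = -fderiv ℝ w (z - t) := by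
    have h := (hw.differentiable one_ne_zero (z - t)).hasFDerivAt.comp t
      ((hasFDerivAt_id t).const_sub z)
    rw [HasFDerivAt.fderiv (f := fun t => w (z - t)) h]
    ext
    simp
  have hkey := integral_inv_mul_dbar_eq hv hvs
  have hsum : (∫ t : ℂ, t⁻¹ * fderiv ℝ w (z - t) 1) + I * ∫ t : ℂ, t⁻¹ * fderiv ℝ w (z - t) I =
      2 * Real.pi * w z := by
    rw [← integral_const_mul, ← integral_add (hex 1) ((hex I).const_mul I), ← neg_inj,
      ← integral_neg]
    rw [sub_zero] at hkey
    rw [← hkey]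
    congr 1 with t
    rw [hfd]
    simp only [neg_apply]
    ring
  rw [wbar, hd.fderiv]
  simp only [smul_apply, smul_eq_mul,
    convolution_precompR_apply _ hloc (hsupp.fderiv ℝ) hcont]
  simp only [convolution_def, ContinuousLinearMap.mul_apply']
  have hpi : (Real.pi : ℂ) ≠ 0 := ofReal_ne_zero.2 Real.pi_ne_zero
  linear_combination 1 / (2 * (Real.pi : ℂ)) * hsum + w z * mul_inv_cancel₀ hpi
end
end

section
/- Let R > 0 and 1 < p < ∞. There exists a constant n = n(R,p) > 0 such that for every w : ℂ → ℂ continuously differentiable with support contained in the open disc B(0,R), the function Tw(z) = −(1/π)·∫_ℂ w(ζ)/(ζ−z) dA(ζ) is real-differentiable and its Wirtinger derivative ∂(Tw)/∂z satisfies ‖∂(Tw)/∂z‖_{L^p(B(0,R))} ≤ n·‖w‖_{L^p(B(0,R))}. -/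
open MeasureTheory Metric Complex Filter

noncomputable section

/-- Second-order Taylor lower bound on the unit interval. -/
lemma taylor_lower_bound {φ φ₁ φ₂ : ℝ → ℝ} {m : ℝ}
    (h₁ : ∀ s ∈ Set.Icc (0:ℝ) 1, HasDerivAt φ (φ₁ s) s)
    (h₂ : ∀ s ∈ Set.Icc (0:ℝ) 1, HasDerivAt φ₁ (φ₂ s) s)
    (hm : ∀ s ∈ Set.Icc (0:ℝ) 1, m ≤ φ₂ s) :
    φ 0 + φ₁ 0 + m / 2 ≤ φ 1 := by
  have key : ∀ (f f' : ℝ → ℝ), (∀ s ∈ Set.Icc (0:ℝ) 1, HasDerivAt f (f' s) s) →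
      (∀ s ∈ Set.Icc (0:ℝ) 1, 0 ≤ f' s) → MonotoneOn f (Set.Icc 0 1) := by
    intro f f' hf hf'
    refine monotoneOn_of_deriv_nonneg (convex_Icc 0 1)
      (fun s hs => (hf s hs).continuousAt.continuousWithinAt)
      (fun s hs => ((hf s (interior_subset hs)).differentiableAt).differentiableWithinAt) ?_
    intro s hs
    rw [(hf s (interior_subset hs)).deriv]
    exact hf' s (interior_subset hs)
  have k1 := key (fun s => φ₁ s - m * s) (fun s => φ₂ s - m)
    (fun s hs => ((h₂ s hs).fun_sub ((hasDerivAt_id s).const_mul m)).congr_deriv (by simp))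
    (fun s hs => by linarith [hm s hs])
  have k2 := key (fun s => φ s - φ₁ 0 * s - m / 2 * s ^ 2) (fun s => φ₁ s - φ₁ 0 - m * s)
    (fun s hs => by
      have := ((h₁ s hs).sub ((hasDerivAt_id s).const_mul (φ₁ 0))).sub
        (((hasDerivAt_id s).pow 2).const_mul (m / 2))
      refine this.congr_deriv ?_
      simp; ring)
    (fun s hs => by
      have := k1 (Set.left_mem_Icc.2 zero_le_one) hs hs.1
      simp at this; linarith)
  have := k2 (Set.left_mem_Icc.2 zero_le_one) (Set.right_mem_Icc.2 zero_le_one) zero_le_one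
  simp at this; linarith

/-- The pointwise algebra behind the Hessian bound of the Bellman function. -/
lemma bellman_hessian_algebra {a b X D Z e t E : ℝ} (hD : 0 < D) (hZ0 : 0 ≤ Z) (hZ1 : Z ≤ 1)
    (he : 1 ≤ e) (ht0 : 0 ≤ t) (ht1 : t ≤ 1) (hE0 : 0 ≤ E) (hED : E ≤ D) (ha : a = X - e * E * b) :
    |a * b| / (e + 1) ≤ 6 * X ^ 2 / D + 2 * D * b ^ 2 + 4 * t * Z * b * X
      - t * (1 - t) * Z ^ 2 * X ^ 2 / D := by
  obtain ⟨W, hW⟩ : ∃ W, X = W * D := ⟨X / D, by field_simp⟩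
  have hq : |a * b| ≤ (e + 1) * (D * W ^ 2 + D * b ^ 2) := by
    have h1 : |X * b| ≤ D * W ^ 2 + D * b ^ 2 := by
      rw [hW, abs_le]; constructor <;> nlinarith [sq_nonneg (W + b), sq_nonneg (W - b), sq_nonneg W, sq_nonneg b]
    have h2 : |e * E * b * b| ≤ e * (D * W ^ 2 + D * b ^ 2) := by
      have : e * E * b * b = e * (E * b ^ 2) := by ring
      rw [this, abs_of_nonneg (by positivity)]
      gcongr
      nlinarith [sq_nonneg b, sq_nonneg W, mul_le_mul_of_nonneg_right hED (sq_nonneg b), mul_nonneg hD.le (sq_nonneg W)]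
    have h3 : a * b = X * b - e * E * b * b := by rw [ha]; ring
    rw [h3]
    linarith [abs_sub (X * b) (e * E * b * b)]
  have h5 : |a * b| / (e + 1) ≤ D * W ^ 2 + D * b ^ 2 := by
    rw [div_le_iff₀ (by linarith)]; linarith
  refine h5.trans ?_
  have e1 : 6 * X ^ 2 / D = 6 * D * W ^ 2 := by rw [hW]; field_simp
  have e2 : t * (1 - t) * Z ^ 2 * X ^ 2 / D = D * (t * (1 - t) * Z ^ 2 * W ^ 2) := by
    rw [hW]; field_simp
  rw [e1, e2, hW]
  have h6 : t * (1 - t) * Z ^ 2 * W ^ 2 ≤ W ^ 2 := by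
    have : t * (1 - t) * Z ^ 2 ≤ 1 := by
      have : t * (1 - t) ≤ 1 := by nlinarith
      have h0 : 0 ≤ t * (1 - t) := by nlinarith
      have : Z ^ 2 ≤ 1 := by nlinarith
      nlinarith
    nlinarith [sq_nonneg W]
  have h7 : -(4 * W ^ 2 + b ^ 2) ≤ 4 * (t * Z) * b * W := by
    have h8 : t * Z ≤ 1 := by nlinarith
    have h9 : 0 ≤ t * Z := by positivity
    nlinarith [sq_nonneg (2 * W + (t * Z) * b), sq_nonneg (2 * W - b), sq_nonneg b, mul_nonneg h9 h9, mul_le_mul h8 h8 h9 zero_le_one]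
  nlinarith [mul_le_mul_of_nonneg_left h6 hD.le, mul_le_mul_of_nonneg_left h7 hD.le]

lemma exists_bellman {p q : ℝ} (hpq : p.HolderConjugate q) (hp2 : p ≤ 2) :
    ∃ (Φ Φu Φv : ℝ → ℝ → ℝ) (C c : ℝ), 0 < C ∧ 0 < c ∧ Measurable (Function.uncurry Φ) ∧
      (∀ u v, 0 < u → 0 < v → 0 ≤ Φ u v ∧ Φ u v ≤ C * (u ^ p + v ^ q)) ∧
      (∀ u v u' v', 0 < u → 0 < v → 0 < u' → 0 < v' →
        Φ u v + Φu u v * (u' - u) + Φv u v * (v' - v) + c * (|u' - u| * |v' - v|) ≤ Φ u' v') := by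
  have hp1 : 1 < p := hpq.lt
  set e := q - 1 with he
  have her : e * (p - 1) = 1 := by
    have := hpq.mul_eq_add; rw [he]; linarith
  have he1 : 1 ≤ e := by nlinarith
  set K := 6 / (p * (p - 1)) with hK
  have hp10 : 0 < p - 1 := by linarith
  have hK0 : 0 < K := by positivity
  have hAv : ∀ u v : ℝ, 0 < u → 0 < v → v ≤ (u + v ^ e) ^ (p - 1) := by
    intro u v hu hv
    calc v = (v ^ e) ^ (p - 1) := by rw [← Real.rpow_mul hv.le, her, Real.rpow_one]
      _ ≤ _ := by
        apply Real.rpow_le_rpow (by positivity) (by linarith) hp10.le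
  refine ⟨fun u v => K * (u + v ^ e) ^ p + v ^ 2 * (u + v ^ e) ^ (2 - p),
    fun u v => K * p * (u + v ^ e) ^ (p - 1) + v ^ 2 * ((2 - p) * (u + v ^ e) ^ (1 - p)),
    fun u v => (K * p * (u + v ^ e) ^ (p - 1) + v ^ 2 * ((2 - p) * (u + v ^ e) ^ (1 - p))) *
      (e * v ^ (e - 1)) + 2 * v * (u + v ^ e) ^ (2 - p),
    (K + 1) * 2 ^ (p - 1), 1 / (2 * (e + 1)), by positivity, by positivity, ?_, ?_, ?_⟩
  · unfold Function.uncurry; fun_prop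
  · intro u v hu hv
    refine ⟨by positivity, ?_⟩
    have hA : 0 < u + v ^ e := by positivity
    have h1 : v ^ 2 * (u + v ^ e) ^ (2 - p) ≤ (u + v ^ e) ^ p := by
      calc v ^ 2 * (u + v ^ e) ^ (2 - p) ≤ ((u + v ^ e) ^ (p - 1)) ^ 2 * (u + v ^ e) ^ (2 - p) := by
            gcongr; exact hAv u v hu hv
        _ = (u + v ^ e) ^ p := by
            rw [← Real.rpow_natCast, ← Real.rpow_mul hA.le, ← Real.rpow_add hA]; congr 1; push_cast; ring
    have h2 : (u + v ^ e) ^ p ≤ 2 ^ (p - 1) * (u ^ p + v ^ q) := by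
      have := NNReal.rpow_add_le_mul_rpow_add_rpow (Real.toNNReal u) (Real.toNNReal (v ^ e)) hp1.le
      rw [← NNReal.coe_le_coe] at this
      push_cast at this
      rw [Real.coe_toNNReal _ hu.le, Real.coe_toNNReal _ (by positivity)] at this
      have e3 : (v ^ e) ^ p = v ^ q := by
        rw [← Real.rpow_mul hv.le]; congr 1
        have := hpq.mul_eq_add; rw [he]; linarith
      rw [e3] at this
      exact this
    calc _ ≤ K * (u + v ^ e) ^ p + (u + v ^ e) ^ p := by linarith
      _ = (K + 1) * (u + v ^ e) ^ p := by ring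
      _ ≤ (K + 1) * (2 ^ (p - 1) * (u ^ p + v ^ q)) := by gcongr
      _ = _ := by ring
  · intro u v u' v' hu hv hu' hv'
    set a := u' - u with ha
    set b := v' - v with hb
    let U : ℝ → ℝ := fun s => u + s * a
    let V : ℝ → ℝ := fun s => v + s * b
    let A : ℝ → ℝ := fun s => U s + V s ^ e
    let X : ℝ → ℝ := fun s => a + e * V s ^ (e - 1) * b
    let Y : ℝ → ℝ := fun s => e * ((e - 1) * V s ^ (e - 1 - 1) * b) * b
    have hU : ∀ s ∈ Set.Icc (0:ℝ) 1, 0 < U s := by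
      intro s hs; simp only [U, ha]
      rcases hs.1.eq_or_lt with h | h
      · rw [← h]; linarith
      · nlinarith [hs.2, mul_pos h hu', mul_nonneg (sub_nonneg.2 hs.2) hu.le]
    have hV : ∀ s ∈ Set.Icc (0:ℝ) 1, 0 < V s := by
      intro s hs; simp only [V, hb]
      rcases hs.1.eq_or_lt with h | h
      · rw [← h]; linarith
      · nlinarith [hs.2, mul_pos h hv', mul_nonneg (sub_nonneg.2 hs.2) hv.le]
    have hA : ∀ s ∈ Set.Icc (0:ℝ) 1, 0 < A s := by
      intro s hs
      have := hU s hs; have := hV s hs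
      simp only [A]; positivity
    have dV : ∀ s, HasDerivAt V b s := fun s => by
      exact (((hasDerivAt_id s).mul_const b).const_add v).congr_deriv (one_mul b)
    have dU : ∀ s, HasDerivAt U a s := fun s => by
      exact (((hasDerivAt_id s).mul_const a).const_add u).congr_deriv (one_mul a)
    have dA : ∀ s ∈ Set.Icc (0:ℝ) 1, HasDerivAt A (X s) s := fun s hs => by
      refine ((dU s).add ((dV s).rpow_const (p := e) (Or.inl (hV s hs).ne'))).congr_deriv ?_
      simp only [X]; ring
    have dX : ∀ s ∈ Set.Icc (0:ℝ) 1, HasDerivAt X (Y s) s := fun s hs => by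
      refine (((((dV s).rpow_const (p := e - 1) (Or.inl (hV s hs).ne')).const_mul e).mul_const b).const_add a).congr_deriv ?_
      simp only [Y]; ring
    have dAp : ∀ (w : ℝ), ∀ s ∈ Set.Icc (0:ℝ) 1, HasDerivAt (fun s => A s ^ w) (X s * w * A s ^ (w - 1)) s :=
      fun w s hs => (dA s hs).rpow_const (Or.inl (hA s hs).ne')
    have main := taylor_lower_bound (φ := fun s => K * A s ^ p + V s ^ 2 * A s ^ (2 - p))
      (φ₁ := fun s => (K * p * A s ^ (p - 1) + V s ^ 2 * ((2 - p) * A s ^ (1 - p))) * X s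
        + 2 * V s * b * A s ^ (2 - p))
      (φ₂ := fun s => (K * p * ((p - 1) * (A s ^ (p - 2) * X s)) + 2 * V s * b * ((2 - p) * A s ^ (1 - p))
        + V s ^ 2 * ((2 - p) * ((1 - p) * (A s ^ (-p) * X s)))) * X s
        + (K * p * A s ^ (p - 1) + V s ^ 2 * ((2 - p) * A s ^ (1 - p))) * Y s
        + 2 * b ^ 2 * A s ^ (2 - p) + 2 * V s * b * ((2 - p) * (A s ^ (1 - p) * X s)))
      (m := |a * b| / (e + 1)) ?_ ?_ ?_
    · simp only [A, U, V, X, zero_mul, add_zero, one_mul] at main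
      have e1 : u + a = u' := by rw [ha]; ring
      have e2 : v + b = v' := by rw [hb]; ring
      rw [e1, e2] at main
      refine le_trans (le_of_eq ?_) main
      rw [abs_mul]; field_simp; ring
    · intro s hs
      refine (((dAp p s hs).const_mul K).add (((dV s).fun_pow 2).fun_mul (dAp (2 - p) s hs))).congr_deriv ?_
      have : (2 - p - 1) = 1 - p := by ring
      rw [this]; push_cast; ring
    · intro s hs
      refine ((((dAp (p - 1) s hs).const_mul (K * p)).fun_add (((dV s).fun_pow 2).fun_mul
        ((dAp (1 - p) s hs).const_mul (2 - p)))).mul (dX s hs) |>.add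
        ((((dV s).const_mul 2).mul_const b).mul (dAp (2 - p) s hs))).congr_deriv ?_
      have e1 : (2 - p - 1) = 1 - p := by ring
      have e2 : (p - 1 - 1) = p - 2 := by ring
      have e3 : (1 - p - 1) = - p := by ring
      have e4 : ((2 : ℕ) : ℝ) = 2 := by norm_num
      rw [e1, e2, e3, e4, Nat.add_one_sub_one, pow_one]; ring
    · intro s hs
      have hVs := hV s hs
      have hAs := hA s hs
      have hUs := hU s hs
      have hvA : V s ≤ A s ^ (p - 1) := hAv _ _ hUs hVs
      have hY : 0 ≤ Y s := by
        have : 0 ≤ e - 1 := by linarith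
        have e4 : Y s = e * (e - 1) * V s ^ (e - 1 - 1) * b ^ 2 := by simp only [Y]; ring
        rw [e4]; positivity
      have h1 : A s ^ (p - 2) = 1 / A s ^ (2 - p) := by
        rw [one_div, ← Real.rpow_neg hAs.le]; congr 1; ring
      have hZ : V s * A s ^ (1 - p) ≤ 1 := by
        calc V s * A s ^ (1 - p) ≤ A s ^ (p - 1) * A s ^ (1 - p) := by gcongr
          _ = 1 := by rw [← Real.rpow_add hAs]; simp
      have h2 : V s ^ 2 * A s ^ (-p) = (V s * A s ^ (1 - p)) ^ 2 / A s ^ (2 - p) := by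
        rw [mul_pow, mul_div_assoc, ← Real.rpow_natCast (A s ^ (1 - p)), ← Real.rpow_mul hAs.le, ← Real.rpow_sub hAs]
        congr 2; push_cast; ring
      have hE : V s ^ (e - 1) ≤ A s ^ (2 - p) := by
        calc V s ^ (e - 1) ≤ (A s ^ (p - 1)) ^ (e - 1) := by
              apply Real.rpow_le_rpow hVs.le hvA; linarith
          _ = A s ^ (2 - p) := by
              rw [← Real.rpow_mul hAs.le]; congr 1; linarith
      have alg := bellman_hessian_algebra (a := a) (b := b) (X := X s) (D := A s ^ (2 - p))
        (Z := V s * A s ^ (1 - p)) (e := e) (t := 2 - p) (E := V s ^ (e - 1)) (by positivity)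
        (by positivity) hZ he1 (by linarith) (by linarith) (by positivity) hE (by simp only [X]; ring)
      have hKp : K * p * (p - 1) = 6 := by rw [hK]; field_simp
      have h3 : 0 ≤ (K * p * A s ^ (p - 1) + V s ^ 2 * ((2 - p) * A s ^ (1 - p))) * Y s := by
        have : 0 ≤ 2 - p := by linarith
        positivity
      refine alg.trans ?_
      have h4 : 6 * X s ^ 2 / A s ^ (2 - p) = K * p * (p - 1) * X s ^ 2 * A s ^ (p - 2) := by
        rw [h1, hKp]; ring
      have h5 : (2 - p) * (1 - (2 - p)) * (V s * A s ^ (1 - p)) ^ 2 * X s ^ 2 / A s ^ (2 - p)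
          = (2 - p) * (p - 1) * X s ^ 2 * (V s ^ 2 * A s ^ (-p)) := by
        rw [h2]; ring
      rw [h4, h5]
      refine le_of_sub_nonneg (le_of_le_of_eq h3 ?_)
      ring

/-- The Gaussian probability density `exp(-|z|²/t) / (π t)` on the plane. -/
def heatK (t : ℝ) (z : ℂ) : ℝ := Real.exp (-t⁻¹ * ‖z‖ ^ 2) / (Real.pi * t)

/-- The second Wirtinger derivative `∂²/∂z²` of `heatK t`. -/
def heatK2 (t : ℝ) (z : ℂ) : ℂ :=
  (starRingEnd ℂ) z ^ 2 * (Real.exp (-t⁻¹ * ‖z‖ ^ 2) : ℂ) / (Real.pi * t ^ 3 : ℝ)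

lemma heatK_pos {t : ℝ} (ht : 0 < t) (z : ℂ) : 0 < heatK t z := by
  unfold heatK; positivity

lemma heatK_neg (t : ℝ) (z : ℂ) : heatK t (-z) = heatK t z := by simp [heatK]

lemma heatK2_neg (t : ℝ) (z : ℂ) : heatK2 t (-z) = heatK2 t z := by simp [heatK2]

lemma continuous_heatK (t : ℝ) : Continuous (heatK t) := by
  unfold heatK; fun_prop

lemma continuous_heatK2 (t : ℝ) : Continuous (heatK2 t) := by
  unfold heatK2; fun_prop

lemma heatK_le {t : ℝ} (ht : 0 < t) (z : ℂ) : heatK t z ≤ 1 / (Real.pi * t) := by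
  unfold heatK
  gcongr
  rw [Real.exp_le_one_iff]
  have : 0 < t⁻¹ := by positivity
  nlinarith [sq_nonneg ‖z‖]

lemma integral_exp_neg_mul_sq_norm {b : ℝ} (hb : 0 < b) :
    ∫ z : ℂ, Real.exp (-b * ‖z‖ ^ 2) = Real.pi / b := by
  rw [GaussianFourier.integral_rexp_neg_mul_sq_norm hb]
  simp

lemma integrable_exp_neg_mul_sq_norm {b : ℝ} (hb : 0 < b) :
    Integrable fun z : ℂ => Real.exp (-b * ‖z‖ ^ 2) := by
  by_contra h
  have := integral_exp_neg_mul_sq_norm hb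
  rw [integral_undef h] at this
  have : 0 < Real.pi / b := by positivity
  linarith

lemma integrable_heatK {t : ℝ} (ht : 0 < t) : Integrable (heatK t) :=
  (integrable_exp_neg_mul_sq_norm (inv_pos.2 ht)).div_const _

lemma integral_heatK {t : ℝ} (ht : 0 < t) : ∫ z, heatK t z = 1 := by
  unfold heatK
  rw [integral_div, integral_exp_neg_mul_sq_norm (inv_pos.2 ht)]
  field_simp

lemma norm_mul_heatK2_le {t : ℝ} (ht : 0 < t) (z : ℂ) :
    ‖(t : ℂ) * heatK2 t z‖ ≤ 4 * heatK (2 * t) z := by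
  have hx : 0 ≤ t⁻¹ * ‖z‖ ^ 2 := by positivity
  set x := t⁻¹ * ‖z‖ ^ 2 with hxd
  have h1 : ‖(t : ℂ) * heatK2 t z‖ = x * Real.exp (-x) / (Real.pi * t) := by
    unfold heatK2
    rw [norm_mul, norm_div, norm_mul, norm_pow, RCLike.norm_conj, Complex.norm_real, Complex.norm_real,
      Complex.norm_real, Real.norm_of_nonneg ht.le, Real.norm_of_nonneg (by positivity),
      Real.norm_of_nonneg (by positivity), neg_mul, ← hxd, hxd]
    field_simp
  have h2 : heatK (2 * t) z = Real.exp (-(x / 2)) / (2 * (Real.pi * t)) := by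
    unfold heatK
    have : -(2 * t)⁻¹ * ‖z‖ ^ 2 = -(x / 2) := by rw [hxd]; field_simp
    rw [this]; ring
  rw [h1, h2]
  have h3 : x ≤ 2 * Real.exp (x / 2) := by linarith [Real.add_one_le_exp (x / 2)]
  have h4 : x * Real.exp (-x) ≤ 2 * Real.exp (-(x / 2)) := by
    calc x * Real.exp (-x) ≤ 2 * Real.exp (x / 2) * Real.exp (-x) := by gcongr
      _ = 2 * Real.exp (-(x / 2)) := by rw [mul_assoc, ← Real.exp_add]; congr 2; ring
  rw [show 4 * (Real.exp (-(x / 2)) / (2 * (Real.pi * t))) = 2 * Real.exp (-(x / 2)) / (Real.pi * t) by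
    field_simp; norm_num]
  gcongr

lemma norm_heatK2_le {t : ℝ} (ht : 0 < t) (z : ℂ) : ‖heatK2 t z‖ ≤ 4 / t * heatK (2 * t) z := by
  have := norm_mul_heatK2_le ht z
  rw [norm_mul, Complex.norm_real, Real.norm_of_nonneg ht.le] at this
  rw [div_mul_eq_mul_div, le_div_iff₀ ht]; linarith

lemma norm_heatK2_le_const {t : ℝ} (ht : 0 < t) (z : ℂ) : ‖heatK2 t z‖ ≤ 2 / (Real.pi * t ^ 2) := by
  refine (norm_heatK2_le ht z).trans ?_
  calc 4 / t * heatK (2 * t) z ≤ 4 / t * (1 / (Real.pi * (2 * t))) := by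
        gcongr; exact heatK_le (by positivity) z
    _ = _ := by field_simp; norm_num

lemma integrable_heatK2 {t : ℝ} (ht : 0 < t) : Integrable (heatK2 t) :=
  ((integrable_heatK (by positivity : 0 < 2 * t)).const_mul (4 / t)).mono'
    (continuous_heatK2 t).aestronglyMeasurable (ae_of_all _ (norm_heatK2_le ht))

lemma integral_eq_zero_of_comp_mul {f : ℂ → ℂ} {a c : ℂ} (ha : ‖a‖ = 1) (hc : c ≠ 1)
    (h : ∀ z, f (a * z) = c * f z) : ∫ z, f z = 0 := by
  have h1 : ∫ z, f (a * z) = ∫ z, f z := by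
    let e := rotation ⟨a, by simp [Submonoid.unitSphere, ha]⟩
    exact e.measurePreserving.integral_comp e.toHomeomorph.measurableEmbedding f
  simp_rw [h, integral_const_mul] at h1
  have : (c - 1) * ∫ z, f z = 0 := by linear_combination h1
  exact (mul_eq_zero.1 this).resolve_left (sub_ne_zero.2 hc)

lemma integral_heatK2 {t : ℝ} : ∫ z, heatK2 t z = 0 := by
  refine integral_eq_zero_of_comp_mul (a := I) (c := -1) (by simp) (by norm_num) fun z => ?_
  simp [heatK2, mul_pow, neg_div]

lemma gaussian_exponent_split {s t : ℝ} (hs : 0 < s) (ht : 0 < t) (x y : ℂ) :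
    -s⁻¹ * ‖x - (y + (t / (s + t) : ℝ) * x)‖ ^ 2 + -t⁻¹ * ‖y + (t / (s + t) : ℝ) * x‖ ^ 2
      = -(s + t)⁻¹ * ‖x‖ ^ 2 + -((s + t) / (s * t)) * ‖y‖ ^ 2 := by
  simp only [← Complex.normSq_eq_norm_sq, Complex.normSq_apply, sub_re, sub_im, add_re, add_im,
    re_ofReal_mul, im_ofReal_mul]
  field_simp
  ring

lemma integral_heatK_mul_heatK2 {s t : ℝ} (hs : 0 < s) (ht : 0 < t) (x : ℂ) :
    ∫ y, (heatK s (x - y) : ℂ) * heatK2 t y = heatK2 (s + t) x := by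
  rw [← integral_add_right_eq_self _ ((t / (s + t) : ℝ) * x : ℂ)]
  set m : ℝ := t / (s + t) with hm
  set b : ℝ := (s + t) / (s * t) with hb
  have hb0 : 0 < b := by positivity
  let G : ℂ → ℂ := fun y => (Real.exp (-b * ‖y‖ ^ 2) : ℂ)
  let D : ℂ := (Real.exp (-(s + t)⁻¹ * ‖x‖ ^ 2) : ℂ) / ((Real.pi * s) * (Real.pi * t ^ 3) : ℝ)
  have key : ∀ y, (heatK s (x - (y + m * x)) : ℂ) * heatK2 t (y + m * x) =
      D * ((m * (starRingEnd ℂ) x) ^ 2 * G y + 2 * (m * (starRingEnd ℂ) x) * ((starRingEnd ℂ) y * G y)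
        + (starRingEnd ℂ) y ^ 2 * G y) := by
    intro y
    have := gaussian_exponent_split hs ht x y
    have h2 : (Real.exp (-s⁻¹ * ‖x - (y + m * x)‖ ^ 2) : ℂ) * (Real.exp (-t⁻¹ * ‖y + m * x‖ ^ 2) : ℂ)
        = (Real.exp (-(s + t)⁻¹ * ‖x‖ ^ 2) : ℂ) * G y := by
      simp only [G]
      rw [← ofReal_mul, ← ofReal_mul, ← Real.exp_add, ← Real.exp_add, this]
    have h3 : (heatK s (x - (y + m * x)) : ℂ) * heatK2 t (y + m * x) =
        ((Real.exp (-s⁻¹ * ‖x - (y + m * x)‖ ^ 2) : ℂ) * (Real.exp (-t⁻¹ * ‖y + m * x‖ ^ 2) : ℂ)) *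
          (starRingEnd ℂ) (y + m * x) ^ 2 / ((Real.pi * s) * (Real.pi * t ^ 3) : ℝ) := by
      simp only [heatK, heatK2]
      push_cast
      field_simp
    rw [h3, h2]
    simp only [D, map_add, map_mul, conj_ofReal]
    ring
  have iG : Integrable G := (integrable_exp_neg_mul_sq_norm hb0).ofReal
  have i2 : Integrable fun y => (starRingEnd ℂ) y ^ 2 * G y := by
    have := (integrable_heatK2 (inv_pos.2 hb0)).mul_const ((Real.pi * b⁻¹ ^ 3 : ℝ) : ℂ)
    refine this.congr (ae_of_all _ fun y => ?_)
    have : ((Real.pi * b⁻¹ ^ 3 : ℝ) : ℂ) ≠ 0 := by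
      rw [ofReal_ne_zero]; positivity
    simp only [heatK2, G, inv_inv]
    rw [div_mul_cancel₀ _ this]
  have i1 : Integrable fun y => (starRingEnd ℂ) y * G y := by
    refine (iG.norm.add i2.norm).mono' (by fun_prop) (ae_of_all _ fun y => ?_)
    simp only [Pi.add_apply, norm_mul, norm_pow, RCLike.norm_conj]
    nlinarith [norm_nonneg (G y), sq_nonneg (‖y‖ - 1), sq_nonneg ‖y‖, mul_nonneg (norm_nonneg (G y)) (sq_nonneg (‖y‖ - 1)), mul_nonneg (norm_nonneg (G y)) (sq_nonneg (‖y‖))]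
  have z1 : ∫ y, (starRingEnd ℂ) y * G y = 0 :=
    integral_eq_zero_of_comp_mul (a := -1) (c := -1) (by simp) (by norm_num) fun z => by simp [G]
  have z2 : ∫ y, (starRingEnd ℂ) y ^ 2 * G y = 0 :=
    integral_eq_zero_of_comp_mul (a := I) (c := -1) (by simp) (by norm_num) fun z => by simp [G, mul_pow]
  have zG : ∫ y, G y = (Real.pi / b : ℝ) := by
    simp only [G]
    rw [integral_complex_ofReal, integral_exp_neg_mul_sq_norm hb0]
  simp_rw [key]
  have j : Integrable fun y => (m * (starRingEnd ℂ) x) ^ 2 * G y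
      + 2 * (m * (starRingEnd ℂ) x) * ((starRingEnd ℂ) y * G y) :=
    (iG.const_mul _).add (i1.const_mul _)
  rw [integral_const_mul, integral_add j i2,
    integral_add (iG.const_mul _) (i1.const_mul _), integral_const_mul, integral_const_mul, z1, z2, zG]
  simp only [D, heatK2, hm, hb]
  have hst : ((s : ℂ) + t) ≠ 0 := by
    rw [← ofReal_add, ofReal_ne_zero]; positivity
  have hs' : (s : ℂ) ≠ 0 := by rw [ofReal_ne_zero]; positivity
  have ht' : (t : ℂ) ≠ 0 := by rw [ofReal_ne_zero]; positivity
  have hpi : (Real.pi : ℂ) ≠ 0 := by rw [ofReal_ne_zero]; positivity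
  push_cast
  field_simp
  ring

lemma integral_heatK_mul_heatK {s t : ℝ} (hs : 0 < s) (ht : 0 < t) (x : ℂ) :
    ∫ y, heatK s (x - y) * heatK t y = heatK (s + t) x := by
  rw [← integral_add_right_eq_self _ ((t / (s + t) : ℝ) * x : ℂ)]
  have key : ∀ y, heatK s (x - (y + (t / (s + t) : ℝ) * x)) * heatK t (y + (t / (s + t) : ℝ) * x) =
      Real.exp (-(s + t)⁻¹ * ‖x‖ ^ 2) / ((Real.pi * s) * (Real.pi * t)) *
        Real.exp (-((s + t) / (s * t)) * ‖y‖ ^ 2) := by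
    intro y
    rw [heatK, heatK, div_mul_div_comm, ← Real.exp_add, gaussian_exponent_split hs ht, Real.exp_add]
    ring
  simp_rw [key]
  rw [integral_const_mul, integral_exp_neg_mul_sq_norm (by positivity), heatK]
  field_simp

/-- Convolution on the plane, with the kernel first. -/
def cv (K f : ℂ → ℂ) (x : ℂ) : ℂ := ∫ y, K (x - y) * f y

lemma integrable_kernel_snd {K f : ℂ → ℂ} (hK : Integrable K) (hf : Integrable f) :
    Integrable (fun p : ℂ × ℂ => K (p.1 - p.2) * f p.2) (volume.prod volume) := by
  have := hf.convolution_integrand (ContinuousLinearMap.mul ℝ ℂ) hK (μ := volume)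
  refine this.congr (ae_of_all _ fun p => ?_)
  simp [mul_comm]

lemma integrable_kernel_fst {K f : ℂ → ℂ} (hK : Integrable K) (hf : Integrable f) :
    Integrable (fun p : ℂ × ℂ => K (p.1 - p.2) * f p.1) (volume.prod volume) := by
  have := (integrable_kernel_snd hK.comp_neg hf).swap
  refine this.congr (ae_of_all _ fun p => ?_)
  simp

lemma integrable_kernel_both {K f g : ℂ → ℂ} (hK : Continuous K) {M : ℝ} (hM : ∀ z, ‖K z‖ ≤ M)
    (hf : Integrable f) (hg : Integrable g) :
    Integrable (fun p : ℂ × ℂ => g p.1 * (K (p.1 - p.2) * f p.2)) (volume.prod volume) := by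
  have := (hg.mul_prod hf).bdd_mul (f := fun p : ℂ × ℂ => K (p.1 - p.2)) (c := M)
    (hK.comp (continuous_fst.sub continuous_snd)).aestronglyMeasurable (ae_of_all _ fun p => hM _)
  refine this.congr (ae_of_all _ fun p => ?_)
  simp only; ring

lemma integrable_cv {K f : ℂ → ℂ} (hK : Integrable K) (hf : Integrable f) : Integrable (cv K f) :=
  (integrable_kernel_snd hK hf).integral_prod_left

lemma integrable_cv_integrand {K f : ℂ → ℂ} (hK : Continuous K) {M : ℝ} (hM : ∀ z, ‖K z‖ ≤ M)
    (hf : Integrable f) (x : ℂ) : Integrable fun y => K (x - y) * f y :=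
  hf.bdd_mul (c := M) (hK.comp (continuous_const.sub continuous_id)).aestronglyMeasurable
    (ae_of_all _ fun _ => hM _)

lemma cv_cv {K₁ K₂ K₃ f : ℂ → ℂ} (h₁ : Continuous K₁) {M : ℝ} (hM : ∀ z, ‖K₁ z‖ ≤ M)
    (h₂ : Integrable K₂) (hf : Integrable f) (h : ∀ x, ∫ y, K₁ (x - y) * K₂ y = K₃ x) (x : ℂ) :
    cv K₁ (cv K₂ f) x = cv K₃ f x := by
  have hi : Integrable (fun p : ℂ × ℂ => K₁ (x - p.1) * (K₂ (p.1 - p.2) * f p.2)) (volume.prod volume) :=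
    (integrable_kernel_snd h₂ hf).bdd_mul (c := M)
      (h₁.comp (continuous_const.sub continuous_fst)).aestronglyMeasurable (ae_of_all _ fun _ => hM _)
  unfold cv
  simp_rw [← integral_const_mul]
  rw [integral_integral_swap hi]
  refine integral_congr_ae (ae_of_all _ fun z => ?_)
  simp only
  rw [← h (x - z), ← integral_mul_const, ← integral_add_right_eq_self _ z]
  refine integral_congr_ae (ae_of_all _ fun y => ?_)
  simp only [add_sub_cancel_right, sub_add_eq_sub_sub_swap]
  ring

lemma integral_mul_cv_comm {K f g : ℂ → ℂ} (hK : Continuous K) {M : ℝ} (hM : ∀ z, ‖K z‖ ≤ M)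
    (hK' : ∀ z, K (-z) = K z) (hf : Integrable f) (hg : Integrable g) :
    ∫ x, g x * cv K f x = ∫ x, f x * cv K g x := by
  unfold cv
  simp_rw [← integral_const_mul]
  rw [integral_integral_swap (integrable_kernel_both hK hM hf hg)]
  refine integral_congr_ae (ae_of_all _ fun y => integral_congr_ae (ae_of_all _ fun x => ?_))
  simp only
  rw [← hK' (x - y), neg_sub]
  ring

section Difference
variable {K u v U V : ℂ → ℂ} {M : ℝ}

lemma integrable_kernel_snd_mul_fst (hK : Integrable K) (hu : Integrable u) (hV : Integrable V)
    (hM : ∀ x, ‖V x‖ ≤ M) :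
    Integrable (fun p : ℂ × ℂ => V p.1 * (K (p.1 - p.2) * u p.2)) (volume.prod volume) :=
  (integrable_kernel_snd hK hu).bdd_mul (c := M) hV.aestronglyMeasurable.comp_fst
    (ae_of_all _ fun _ => hM _)

lemma integral_kernel_snd_mul_fst (hK : Integrable K) (hu : Integrable u) (hV : Integrable V)
    (hM : ∀ x, ‖V x‖ ≤ M) :
    ∫ p : ℂ × ℂ, V p.1 * (K (p.1 - p.2) * u p.2) ∂(volume.prod volume) = ∫ x, V x * cv K u x := by
  rw [integral_prod _ (integrable_kernel_snd_mul_fst hK hu hV hM)]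
  unfold cv
  simp_rw [← integral_const_mul]

lemma integrable_mul_of_bdd (hu : Integrable u) (hv : Integrable v) (hM : ∀ x, ‖v x‖ ≤ M) :
    Integrable (fun x => u x * v x) :=
  hu.mul_bdd (c := M) hv.aestronglyMeasurable (ae_of_all _ hM)

lemma integrable_kernel_mul_sub_mul_sub (hK : Integrable K) (hu : Integrable u) (hv : Integrable v)
    (hU : Integrable U) (hV : Integrable V)
    (bv : ∀ x, ‖v x‖ ≤ M) (bU : ∀ x, ‖U x‖ ≤ M) (bV : ∀ x, ‖V x‖ ≤ M) :
    Integrable (fun p : ℂ × ℂ => K (p.1 - p.2) * ((u p.2 - U p.1) * (v p.2 - V p.1)))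
      (volume.prod volume) := by
  have := (((integrable_kernel_snd hK (integrable_mul_of_bdd hu hv bv)).sub
    (integrable_kernel_snd_mul_fst hK hu hV bV)).sub
    (integrable_kernel_snd_mul_fst hK hv hU bU)).add
    (integrable_kernel_fst hK (integrable_mul_of_bdd hU hV bV))
  refine this.congr (ae_of_all _ fun p => ?_)
  simp only [Pi.add_apply, Pi.sub_apply]; ring

lemma integral_kernel_mul_sub_mul_sub (hK : Integrable K) (hK0 : ∫ z, K z = 0)
    (hu : Integrable u) (hv : Integrable v) (hU : Integrable U) (hV : Integrable V)
    (bv : ∀ x, ‖v x‖ ≤ M) (bU : ∀ x, ‖U x‖ ≤ M) (bV : ∀ x, ‖V x‖ ≤ M) :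
    ∫ p : ℂ × ℂ, K (p.1 - p.2) * ((u p.2 - U p.1) * (v p.2 - V p.1)) ∂(volume.prod volume) =
      -((∫ x, V x * cv K u x) + ∫ x, U x * cv K v x) := by
  have i1 := integrable_kernel_snd hK (integrable_mul_of_bdd hu hv bv)
  have i2 := integrable_kernel_snd_mul_fst hK hu hV bV
  have i3 := integrable_kernel_snd_mul_fst hK hv hU bU
  have i4 := integrable_kernel_fst hK (integrable_mul_of_bdd hU hV bV)
  have j1 : Integrable (fun p : ℂ × ℂ => K (p.1 - p.2) * (u p.2 * v p.2) -
    V p.1 * (K (p.1 - p.2) * u p.2)) (volume.prod volume) := i1.sub i2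
  have j2 : Integrable (fun p : ℂ × ℂ => K (p.1 - p.2) * (u p.2 * v p.2) -
    V p.1 * (K (p.1 - p.2) * u p.2) - U p.1 * (K (p.1 - p.2) * v p.2)) (volume.prod volume) :=
    j1.sub i3
  have e1 : ∫ p : ℂ × ℂ, K (p.1 - p.2) * (u p.2 * v p.2) ∂(volume.prod volume) = 0 := by
    rw [integral_prod_symm _ i1]
    refine integral_eq_zero_of_ae (ae_of_all _ fun y => ?_)
    simp only [integral_mul_const, Pi.zero_apply]
    rw [integral_sub_right_eq_self K, hK0, zero_mul]
  have e4 : ∫ p : ℂ × ℂ, K (p.1 - p.2) * (U p.1 * V p.1) ∂(volume.prod volume) = 0 := by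
    rw [integral_prod _ i4]
    refine integral_eq_zero_of_ae (ae_of_all _ fun y => ?_)
    simp only [integral_mul_const, Pi.zero_apply]
    rw [integral_sub_left_eq_self K, hK0, zero_mul]
  rw [← integral_kernel_snd_mul_fst hK hu hV bV, ← integral_kernel_snd_mul_fst hK hv hU bU]
  calc _ = ∫ p : ℂ × ℂ, (K (p.1 - p.2) * (u p.2 * v p.2) - V p.1 * (K (p.1 - p.2) * u p.2)
        - U p.1 * (K (p.1 - p.2) * v p.2) + K (p.1 - p.2) * (U p.1 * V p.1)) ∂(volume.prod volume) := by
        refine integral_congr_ae (ae_of_all _ fun p => ?_)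
        simp only; ring
    _ = _ := by
        rw [integral_add j2 i4, integral_sub j1 i3, integral_sub i1 i2, e1, e4]
        ring

end Difference

/-- The pairing of `g` with `∂²/∂z²` of the heat extension of `f`. -/
def heatPairing (t : ℝ) (f g : ℂ → ℂ) : ℂ := ∫ x, g x * cv (heatK2 t) f x

lemma heatPairing_comm {t : ℝ} (ht : 0 < t) {f g : ℂ → ℂ} (hf : Integrable f) (hg : Integrable g) :
    heatPairing t f g = heatPairing t g f :=
  integral_mul_cv_comm (continuous_heatK2 t) (norm_heatK2_le_const ht) (heatK2_neg t) hf hg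

/-- The heat kernel as a complex-valued function. -/
def heatKC (t : ℝ) (z : ℂ) : ℂ := heatK t z

lemma continuous_heatKC (t : ℝ) : Continuous (heatKC t) :=
  continuous_ofReal.comp (continuous_heatK t)

lemma integrable_heatKC {t : ℝ} (ht : 0 < t) : Integrable (heatKC t) := (integrable_heatK ht).ofReal

lemma norm_heatKC {t : ℝ} (ht : 0 < t) (z : ℂ) : ‖heatKC t z‖ = heatK t z := by
  rw [heatKC, Complex.norm_real, Real.norm_of_nonneg (heatK_pos ht z).le]

lemma norm_heatKC_le {t : ℝ} (ht : 0 < t) (z : ℂ) : ‖heatKC t z‖ ≤ 1 / (Real.pi * t) := by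
  rw [norm_heatKC ht]; exact heatK_le ht z

lemma cv_heatKC_heatKC {s t : ℝ} (hs : 0 < s) (ht : 0 < t) {f : ℂ → ℂ} (hf : Integrable f) :
    cv (heatKC s) (cv (heatKC t) f) = cv (heatKC (s + t)) f := by
  refine funext (cv_cv (continuous_heatKC s) (norm_heatKC_le hs) (integrable_heatKC ht) hf fun x => ?_)
  rw [heatKC, ← integral_heatK_mul_heatK hs ht x, ← integral_complex_ofReal]
  simp [heatKC]

lemma cv_heatKC_heatK2 {s t : ℝ} (hs : 0 < s) (ht : 0 < t) {f : ℂ → ℂ} (hf : Integrable f) :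
    cv (heatKC s) (cv (heatK2 t) f) = cv (heatK2 (s + t)) f :=
  funext (cv_cv (continuous_heatKC s) (norm_heatKC_le hs) (integrable_heatK2 ht) hf
    (integral_heatK_mul_heatK2 hs ht))

lemma cv_heatK2_heatKC {s t : ℝ} (hs : 0 < s) (ht : 0 < t) {f : ℂ → ℂ} (hf : Integrable f) :
    cv (heatK2 s) (cv (heatKC t) f) = cv (heatK2 (t + s)) f := by
  refine funext (cv_cv (continuous_heatK2 s) (norm_heatK2_le_const hs) (integrable_heatKC ht) hf fun x => ?_)
  rw [← integral_heatK_mul_heatK2 ht hs x, ← integral_sub_left_eq_self _ _ x]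
  refine integral_congr_ae (ae_of_all _ fun y => ?_)
  simp only [sub_sub_cancel, heatKC, mul_comm]

lemma integral_cv_heatKC_mul {s t r : ℝ} (hs : 0 < s) (ht : 0 < t) (hr : 0 < r) {f g : ℂ → ℂ}
    (hf : Integrable f) (hg : Integrable g) :
    ∫ x, cv (heatKC r) g x * cv (heatK2 s) (cv (heatKC t) f) x = heatPairing (r + (t + s)) f g := by
  rw [cv_heatK2_heatKC hs ht hf, heatPairing, ← cv_heatKC_heatK2 hr (by positivity) hf]
  rw [integral_mul_cv_comm (continuous_heatKC r) (norm_heatKC_le hr) _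
    (integrable_cv (integrable_heatK2 (by positivity)) hf) hg]
  · simp_rw [mul_comm]
  · intro z; simp [heatKC, heatK_neg]

/-- Nonnegative, integrable and bounded functions on the plane. -/
structure Tame (f : ℂ → ℝ) : Prop where
  nonneg : ∀ x, 0 ≤ f x
  integrable : Integrable f
  bdd : ∃ M, ∀ x, f x ≤ M

/-- The heat extension of a real function. -/
def heatExt (t : ℝ) (f : ℂ → ℝ) (x : ℂ) : ℝ := ∫ y, heatK t (x - y) * f y

lemma ofReal_heatExt (t : ℝ) (f : ℂ → ℝ) (x : ℂ) :
    (heatExt t f x : ℂ) = cv (heatKC t) (fun y => (f y : ℂ)) x := by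
  unfold heatExt cv heatKC
  rw [← integral_complex_ofReal]
  simp

lemma ofReal_heatExt_fun (t : ℝ) (f : ℂ → ℝ) :
    (fun x => (heatExt t f x : ℂ)) = cv (heatKC t) (fun y => (f y : ℂ)) :=
  funext (ofReal_heatExt t f)

lemma integrable_heatK_sub {t : ℝ} (ht : 0 < t) (x : ℂ) : Integrable fun y => heatK t (x - y) :=
  (integrable_heatK ht).comp_sub_left x

lemma integral_heatK_sub {t : ℝ} (ht : 0 < t) (x : ℂ) : ∫ y, heatK t (x - y) = 1 := by
  rw [integral_sub_left_eq_self (heatK t), integral_heatK ht]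

lemma integrable_heatK_mul {t : ℝ} (ht : 0 < t) {f : ℂ → ℝ} (hf : Integrable f) (x : ℂ) :
    Integrable fun y => heatK t (x - y) * f y := by
  refine hf.bdd_mul (c := 1 / (Real.pi * t))
    ((continuous_heatK t).comp (continuous_const.sub continuous_id)).aestronglyMeasurable
    (ae_of_all _ fun y => ?_)
  rw [Real.norm_of_nonneg (heatK_pos ht _).le]
  exact heatK_le ht _

lemma integrable_heatK_prod {t : ℝ} (ht : 0 < t) {f : ℂ → ℝ} (hf : Integrable f) :
    Integrable (fun p : ℂ × ℂ => heatK t (p.1 - p.2) * f p.2) (volume.prod volume) := by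
  have := (integrable_kernel_snd (integrable_heatKC ht) hf.ofReal).re
  refine this.congr (ae_of_all _ fun p => ?_)
  simp [heatKC]

lemma integrable_heatExt {t : ℝ} (ht : 0 < t) {f : ℂ → ℝ} (hf : Integrable f) :
    Integrable (heatExt t f) :=
  (integrable_heatK_prod ht hf).integral_prod_left

lemma integral_heatExt {t : ℝ} (ht : 0 < t) {f : ℂ → ℝ} (hf : Integrable f) :
    ∫ x, heatExt t f x = ∫ x, f x := by
  unfold heatExt
  rw [integral_integral_swap (integrable_heatK_prod ht hf)]
  refine integral_congr_ae (ae_of_all _ fun y => ?_)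
  simp only [integral_mul_const]
  rw [integral_sub_right_eq_self (heatK t), integral_heatK ht, one_mul]

lemma heatExt_heatExt {s t : ℝ} (hs : 0 < s) (ht : 0 < t) {f : ℂ → ℝ} (hf : Integrable f) :
    heatExt s (heatExt t f) = heatExt (s + t) f := by
  have hfc : Integrable (fun x => (f x : ℂ)) := hf.ofReal
  ext x
  apply Complex.ofReal_injective
  rw [ofReal_heatExt, ofReal_heatExt_fun, cv_heatKC_heatKC hs ht hfc, ofReal_heatExt]

lemma Tame.heatExt {t : ℝ} (ht : 0 < t) {f : ℂ → ℝ} (hf : Tame f) : Tame (heatExt t f) := by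
  refine ⟨fun x => integral_nonneg fun y => mul_nonneg (heatK_pos ht _).le (hf.nonneg y),
    integrable_heatExt ht hf.integrable, ?_⟩
  obtain ⟨M, hM⟩ := hf.bdd
  refine ⟨M, fun x => ?_⟩
  calc _ ≤ ∫ y, heatK t (x - y) * M :=
        integral_mono (integrable_heatK_mul ht hf.integrable x)
          ((integrable_heatK_sub ht x).mul_const M) fun y => by
            have := (heatK_pos ht (x - y)).le
            have := hM y
            simp only; gcongr
    _ = M := by rw [integral_mul_const, integral_heatK_sub ht, one_mul]

lemma Tame.heatExt_pos {t : ℝ} (ht : 0 < t) {f : ℂ → ℝ} (hf : Tame f) (h : ∫ x, f x ≠ 0) (x : ℂ) :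
    0 < _root_.heatExt t f x := by
  refine lt_of_le_of_ne ((hf.heatExt ht).nonneg x) fun h0 => h ?_
  have := (integral_eq_zero_iff_of_nonneg
    (fun y => mul_nonneg (heatK_pos ht (x - y)).le (hf.nonneg y))
    (integrable_heatK_mul ht hf.integrable x)).1 h0.symm
  refine integral_eq_zero_of_ae ?_
  filter_upwards [this] with y hy
  simpa [(heatK_pos ht (x - y)).ne'] using hy

lemma Tame.integrable_rpow {f : ℂ → ℝ} (hf : Tame f) {p : ℝ} (hp : 1 < p) :
    Integrable fun x => f x ^ p := by
  obtain ⟨M, hM⟩ := hf.bdd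
  refine (hf.integrable.const_mul (M ^ (p - 1))).mono'
    (hf.integrable.aemeasurable.pow_const p).aestronglyMeasurable (ae_of_all _ fun x => ?_)
  have h0 := hf.nonneg x
  rw [Real.norm_of_nonneg (by positivity)]
  calc f x ^ p = f x ^ (p - 1) * f x := by
        rcases h0.eq_or_lt with h | h
        · rw [← h, Real.zero_rpow (by linarith), mul_zero]
        · rw [← Real.rpow_add_one h.ne']; ring_nf
    _ ≤ M ^ (p - 1) * f x := by
        gcongr
        exact hM x

lemma jensen_step {r : ℝ} (hr : 0 < r) {u v α β l m : ℂ → ℝ} {D : ℂ → ℂ → ℝ}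
    (hu : Integrable u) (hv : Integrable v) (hα : Integrable α) (hβ : Integrable β)
    (hD : Integrable (fun p : ℂ × ℂ => heatK r (p.1 - p.2) * D p.1 p.2) (volume.prod volume))
    (h : ∀ x y, α x + l x * (u y - heatExt r u x) + m x * (v y - heatExt r v x) + D x y ≤ β y) :
    (∫ x, α x) + ∫ p : ℂ × ℂ, heatK r (p.1 - p.2) * D p.1 p.2 ∂(volume.prod volume) ≤ ∫ x, β x := by
  rw [integral_prod _ hD, ← integral_heatExt hr hβ, ← integral_add hα hD.integral_prod_left]
  refine integral_mono_ae (hα.add hD.integral_prod_left) (integrable_heatExt hr hβ) ?_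
  filter_upwards [hD.prod_right_ae] with x hx
  have i0 := integrable_heatK_sub hr x
  have iu := integrable_heatK_mul hr hu x
  have iv := integrable_heatK_mul hr hv x
  have c1 : Integrable fun y => (α x - l x * heatExt r u x - m x * heatExt r v x) * heatK r (x - y) :=
    i0.const_mul _
  have c2 : Integrable fun y => l x * (heatK r (x - y) * u y) := iu.const_mul _
  have c3 : Integrable fun y => m x * (heatK r (x - y) * v y) := iv.const_mul _
  have c12 : Integrable fun y => (α x - l x * heatExt r u x - m x * heatExt r v x) * heatK r (x - y)
    + l x * (heatK r (x - y) * u y) := c1.add c2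
  have c123 : Integrable fun y => (α x - l x * heatExt r u x - m x * heatExt r v x) * heatK r (x - y)
    + l x * (heatK r (x - y) * u y) + m x * (heatK r (x - y) * v y) := c12.add c3
  have e : α x + ∫ y, heatK r (x - y) * D x y = ∫ y, ((α x - l x * heatExt r u x - m x * heatExt r v x) *
      heatK r (x - y) + l x * (heatK r (x - y) * u y) + m x * (heatK r (x - y) * v y)
        + heatK r (x - y) * D x y) := by
    rw [integral_add c123 hx, integral_add c12 c3, integral_add c1 c2]
    simp only [integral_const_mul]
    rw [integral_heatK_sub hr]
    change _ = _ * 1 + l x * heatExt r u x + m x * heatExt r v x + _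
    ring
  change α x + ∫ y, heatK r (x - y) * D x y ≤ _
  rw [e]
  refine integral_mono (c123.add hx) (integrable_heatK_mul hr hβ x) fun y => ?_
  have := mul_le_mul_of_nonneg_left (h x y) (heatK_pos hr (x - y)).le
  simp only
  linarith

lemma rpow_tangent_le {p U y : ℝ} (hp : 1 < p) (hU : 0 < U) (hy : 0 ≤ y) :
    U ^ p + p * U ^ (p - 1) * (y - U) ≤ y ^ p := by
  have h := one_add_mul_self_le_rpow_one_add (s := y / U - 1) (p := p)
    (by have : 0 ≤ y / U := by positivity
        linarith) hp.le
  rw [add_sub_cancel, Real.div_rpow hy hU.le, le_div_iff₀ (by positivity)] at h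
  calc _ = (1 + p * (y / U - 1)) * U ^ p := by
        rw [Real.rpow_sub_one hU.ne']; field_simp
    _ ≤ _ := h

lemma Tame.integral_heatExt_rpow_le {t p : ℝ} (ht : 0 < t) (hp : 1 < p) {f : ℂ → ℝ} (hf : Tame f)
    (h0 : ∫ x, f x ≠ 0) : ∫ x, _root_.heatExt t f x ^ p ≤ ∫ x, f x ^ p := by
  have := jensen_step ht hf.integrable hf.integrable ((hf.heatExt ht).integrable_rpow hp)
    (hf.integrable_rpow hp) (l := fun x => p * _root_.heatExt t f x ^ (p - 1)) (m := fun _ => 0)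
    (D := fun _ _ => 0) (by simp)
    (fun x y => by simpa using rpow_tangent_le hp (hf.heatExt_pos ht h0 x) (hf.nonneg y))
  simpa using this

lemma Tame.norm_ofReal_le {f : ℂ → ℝ} (hf : Tame f) {M : ℝ} (hM : ∀ x, f x ≤ M) (x : ℂ) :
    ‖(f x : ℂ)‖ ≤ M := by
  rw [Complex.norm_real, Real.norm_of_nonneg (hf.nonneg x)]; exact hM x

lemma Tame.ofReal_integrable {f : ℂ → ℝ} (hf : Tame f) : Integrable (fun x => (f x : ℂ)) :=
  hf.integrable.ofReal

lemma Tame.integrable_heatK_mul_abs {r : ℝ} (hr : 0 < r) {u v U V : ℂ → ℝ} (hu : Tame u) (hv : Tame v)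
    (hU : Tame U) (hV : Tame V) :
    Integrable (fun p : ℂ × ℂ => heatK r (p.1 - p.2) * (|u p.2 - U p.1| * |v p.2 - V p.1|))
      (volume.prod volume) := by
  obtain ⟨M₁, h₁⟩ := hv.bdd
  obtain ⟨M₂, h₂⟩ := hU.bdd
  obtain ⟨M₃, h₃⟩ := hV.bdd
  have := (integrable_kernel_mul_sub_mul_sub (M := max M₁ (max M₂ M₃)) (integrable_heatKC hr)
    hu.ofReal_integrable hv.ofReal_integrable hU.ofReal_integrable hV.ofReal_integrable
    (hv.norm_ofReal_le fun x => (h₁ x).trans (by simp))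
    (hU.norm_ofReal_le fun x => (h₂ x).trans (by simp))
    (hV.norm_ofReal_le fun x => (h₃ x).trans (by simp))).norm
  refine this.congr (ae_of_all _ fun p => ?_)
  simp only [norm_mul, norm_heatKC hr, ← ofReal_sub, Complex.norm_real, Real.norm_eq_abs]

lemma norm_heatPairing_le {s : ℝ} (hs : 0 < s) {f g : ℂ → ℝ} (hf : Tame f) (hg : Tame g) :
    ‖(s : ℂ) * heatPairing (7 * s) (fun x => (f x : ℂ)) (fun x => (g x : ℂ))‖ ≤
      2 * ∫ p : ℂ × ℂ, heatK (2 * s) (p.1 - p.2) *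
        (|heatExt (2 * s) f p.2 - heatExt (4 * s) f p.1| *
          |heatExt (2 * s) g p.2 - heatExt (4 * s) g p.1|) ∂(volume.prod volume) := by
  have hs2 : 0 < 2 * s := by positivity
  have hs4 : 0 < 4 * s := by positivity
  have hu := hf.heatExt hs2
  have hv := hg.heatExt hs2
  have hU := hf.heatExt hs4
  have hV := hg.heatExt hs4
  obtain ⟨M₁, h₁⟩ := hv.bdd
  obtain ⟨M₂, h₂⟩ := hU.bdd
  obtain ⟨M₃, h₃⟩ := hV.bdd
  have key := integral_kernel_mul_sub_mul_sub (M := max M₁ (max M₂ M₃)) (integrable_heatK2 hs)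
    integral_heatK2
    hu.ofReal_integrable hv.ofReal_integrable hU.ofReal_integrable hV.ofReal_integrable
    (hv.norm_ofReal_le fun x => (h₁ x).trans (by simp))
    (hU.norm_ofReal_le fun x => (h₂ x).trans (by simp))
    (hV.norm_ofReal_le fun x => (h₃ x).trans (by simp))
  have e1 := integral_cv_heatKC_mul hs hs2 hs4 hf.ofReal_integrable hg.ofReal_integrable
  have e2 := integral_cv_heatKC_mul hs hs2 hs4 hg.ofReal_integrable hf.ofReal_integrable
  simp only [← ofReal_heatExt_fun, ← ofReal_heatExt] at e1 e2
  rw [e1, e2, heatPairing_comm (by positivity) hg.ofReal_integrable hf.ofReal_integrable,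
    show 4 * s + (2 * s + s) = 7 * s by ring] at key
  have e3 : (s : ℂ) * heatPairing (7 * s) (fun x => (f x : ℂ)) (fun x => (g x : ℂ)) =
      -(1 / 2) * ∫ p : ℂ × ℂ, (s : ℂ) * (heatK2 s (p.1 - p.2) * (((heatExt (2 * s) f p.2 : ℂ) - heatExt (4 * s) f p.1) *
          ((heatExt (2 * s) g p.2 : ℂ) - heatExt (4 * s) g p.1))) ∂(volume.prod volume) := by
    rw [integral_const_mul, key]; ring
  rw [e3, norm_mul]
  have e4 : ‖∫ p : ℂ × ℂ, (s : ℂ) * (heatK2 s (p.1 - p.2) * (((heatExt (2 * s) f p.2 : ℂ) - heatExt (4 * s) f p.1) *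
          ((heatExt (2 * s) g p.2 : ℂ) - heatExt (4 * s) g p.1))) ∂(volume.prod volume)‖ ≤
      ∫ p : ℂ × ℂ, 4 * (heatK (2 * s) (p.1 - p.2) *
        (|heatExt (2 * s) f p.2 - heatExt (4 * s) f p.1| *
          |heatExt (2 * s) g p.2 - heatExt (4 * s) g p.1|)) ∂(volume.prod volume) := by
    refine norm_integral_le_of_norm_le ((hu.integrable_heatK_mul_abs hs2 hv hU hV).const_mul 4)
      (ae_of_all _ fun p => ?_)
    rw [← mul_assoc, norm_mul, ← mul_assoc 4]
    refine mul_le_mul (norm_mul_heatK2_le hs _) ?_ (norm_nonneg _)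
      (mul_nonneg (by norm_num) (heatK_pos hs2 _).le)
    rw [norm_mul, ← ofReal_sub, ← ofReal_sub, Complex.norm_real, Complex.norm_real]; rfl
  rw [integral_const_mul (4 : ℝ)] at e4
  have : ‖(-(1 / 2) : ℂ)‖ = 1 / 2 := by norm_num
  rw [this]; linarith

lemma sum_norm_heatPairing_le {p q : ℝ} (hpq : p.HolderConjugate q) (hp2 : p ≤ 2) :
    ∃ A > 0, ∀ f g : ℂ → ℝ, Tame f → Tame g → ∀ b > 0, ∀ N : ℕ,
      ∑ j ∈ Finset.range N, ‖((b * 2 ^ j : ℝ) : ℂ) *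
        heatPairing (7 * (b * 2 ^ j)) (fun x => (f x : ℂ)) (fun x => (g x : ℂ))‖ ≤
      A * ((∫ x, f x ^ p) + ∫ x, g x ^ q) := by
  obtain ⟨Φ, Φu, Φv, C, c, hC, hc, hmeas, hbd, hconv⟩ := exists_bellman hpq hp2
  have hp := hpq.lt
  have hq := hpq.symm.lt
  refine ⟨2 * C / c, by positivity, fun f g hf hg b hb N => ?_⟩
  have hfp : 0 ≤ ∫ x, f x ^ p := integral_nonneg fun x => Real.rpow_nonneg (hf.nonneg x) p
  have hgq : 0 ≤ ∫ x, g x ^ q := integral_nonneg fun x => Real.rpow_nonneg (hg.nonneg x) q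
  by_cases hf0 : ∫ x, f x = 0
  · have h0 := (integral_eq_zero_iff_of_nonneg hf.nonneg hf.integrable).1 hf0
    have : ∀ t > 0, heatPairing t (fun x => (f x : ℂ)) (fun x => (g x : ℂ)) = 0 := by
      intro t ht
      rw [heatPairing_comm ht hf.ofReal_integrable hg.ofReal_integrable]
      refine integral_eq_zero_of_ae ?_
      filter_upwards [h0] with x hx
      simp [hx]
    rw [Finset.sum_eq_zero fun j _ => by rw [this _ (by positivity), mul_zero, norm_zero]]
    positivity
  by_cases hg0 : ∫ x, g x = 0
  · have h0 := (integral_eq_zero_iff_of_nonneg hg.nonneg hg.integrable).1 hg0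
    have : ∀ t > 0, heatPairing t (fun x => (f x : ℂ)) (fun x => (g x : ℂ)) = 0 := by
      intro t ht
      refine integral_eq_zero_of_ae ?_
      filter_upwards [h0] with x hx
      simp [hx]
    rw [Finset.sum_eq_zero fun j _ => by rw [this _ (by positivity), mul_zero, norm_zero]]
    positivity
  let F : ℝ → ℝ := fun t => ∫ x, Φ (heatExt t f x) (heatExt t g x)
  have hle : ∀ t > 0, ∀ x, Φ (heatExt t f x) (heatExt t g x) ≤ C * (heatExt t f x ^ p + heatExt t g x ^ q) :=
    fun t ht x => (hbd _ _ (hf.heatExt_pos ht hf0 x) (hg.heatExt_pos ht hg0 x)).2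
  have hnn : ∀ t > 0, ∀ x, 0 ≤ Φ (heatExt t f x) (heatExt t g x) :=
    fun t ht x => (hbd _ _ (hf.heatExt_pos ht hf0 x) (hg.heatExt_pos ht hg0 x)).1
  have hdom : ∀ t > 0, Integrable fun x => C * (heatExt t f x ^ p + heatExt t g x ^ q) := fun t ht =>
    (((hf.heatExt ht).integrable_rpow hp).add ((hg.heatExt ht).integrable_rpow hq)).const_mul C
  have hint : ∀ t > 0, Integrable fun x => Φ (heatExt t f x) (heatExt t g x) := fun t ht => by
    refine (hdom t ht).mono' ?_ (ae_of_all _ fun x => ?_)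
    · exact (hmeas.comp_aemeasurable ((hf.heatExt ht).integrable.aemeasurable.prodMk
        (hg.heatExt ht).integrable.aemeasurable)).aestronglyMeasurable
    · rw [Real.norm_of_nonneg (hnn t ht x)]; exact hle t ht x
  have step : ∀ s : ℝ, 0 < s → c / 2 * ‖(s : ℂ) * heatPairing (7 * s) (fun x => (f x : ℂ)) (fun x => (g x : ℂ))‖
      ≤ F (2 * s) - F (4 * s) := by
    intro s hs
    have h2 : 0 < 2 * s := by positivity
    have h4 : 0 < 4 * s := by positivity
    have ef : heatExt (2 * s) (heatExt (2 * s) f) = heatExt (4 * s) f := by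
      rw [heatExt_heatExt h2 h2 hf.integrable]; ring_nf
    have eg : heatExt (2 * s) (heatExt (2 * s) g) = heatExt (4 * s) g := by
      rw [heatExt_heatExt h2 h2 hg.integrable]; ring_nf
    have hI := ((hf.heatExt h2).integrable_heatK_mul_abs h2 (hg.heatExt h2) (hf.heatExt h4)
      (hg.heatExt h4)).const_mul c
    have := jensen_step h2 (hf.heatExt h2).integrable (hg.heatExt h2).integrable (hint _ h4) (hint _ h2)
      (l := fun x => Φu (heatExt (4 * s) f x) (heatExt (4 * s) g x))
      (m := fun x => Φv (heatExt (4 * s) f x) (heatExt (4 * s) g x))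
      (D := fun x y => c * (|heatExt (2 * s) f y - heatExt (4 * s) f x| *
          |heatExt (2 * s) g y - heatExt (4 * s) g x|))
      (hI.congr (ae_of_all _ fun p => by simp only; ring))
      (fun x y => by
        rw [ef, eg]
        exact hconv _ _ _ _ (hf.heatExt_pos h4 hf0 x) (hg.heatExt_pos h4 hg0 x)
          (hf.heatExt_pos h2 hf0 y) (hg.heatExt_pos h2 hg0 y))
    simp_rw [mul_left_comm _ c] at this
    rw [integral_const_mul] at this
    have h3 := mul_le_mul_of_nonneg_left (norm_heatPairing_le hs hf hg) (by positivity : 0 ≤ c / 2)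
    change F (4 * s) + _ ≤ F (2 * s) at this
    linarith
  have tele : ∀ n : ℕ, c / 2 * ∑ j ∈ Finset.range n, ‖((b * 2 ^ j : ℝ) : ℂ) *
      heatPairing (7 * (b * 2 ^ j)) (fun x => (f x : ℂ)) (fun x => (g x : ℂ))‖ ≤
      F (2 * b) - F (2 * (b * 2 ^ n)) := by
    intro n
    induction n with
    | zero => simp
    | succ n ih =>
      rw [Finset.sum_range_succ, mul_add]
      have := step (b * 2 ^ n) (by positivity)
      rw [show 2 * (b * 2 ^ (n + 1)) = 4 * (b * 2 ^ n) by ring]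
      linarith
  have hb2 : 0 < 2 * b := by positivity
  have hF0 : 0 ≤ F (2 * (b * 2 ^ N)) := integral_nonneg (hnn _ (by positivity))
  have hF1 : F (2 * b) ≤ C * ((∫ x, f x ^ p) + ∫ x, g x ^ q) := by
    refine (integral_mono (hint _ hb2) (hdom _ hb2) (hle _ hb2)).trans ?_
    rw [integral_const_mul, integral_add ((hf.heatExt hb2).integrable_rpow hp)
      ((hg.heatExt hb2).integrable_rpow hq)]
    refine mul_le_mul_of_nonneg_left (add_le_add ?_ ?_) hC.le
    · exact hf.integral_heatExt_rpow_le hb2 hp hf0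
    · exact hg.integral_heatExt_rpow_le hb2 hq hg0
  have hN := tele N
  rw [div_mul_eq_mul_div, le_div_iff₀ hc]
  nlinarith

lemma exists_sum_norm_heatPairing_le {p q : ℝ} (hpq : p.HolderConjugate q) :
    ∃ A > 0, ∀ f g : ℂ → ℝ, Tame f → Tame g → ∀ b > 0, ∀ N : ℕ,
      ∑ j ∈ Finset.range N, ‖((b * 2 ^ j : ℝ) : ℂ) *
        heatPairing (7 * (b * 2 ^ j)) (fun x => (f x : ℂ)) (fun x => (g x : ℂ))‖ ≤
      A * ((∫ x, f x ^ p) + ∫ x, g x ^ q) := by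
  rcases le_total p 2 with hp | hp
  · exact sum_norm_heatPairing_le hpq hp
  · have hq : q ≤ 2 := by
      rw [hpq.conjugate_eq, div_le_iff₀ hpq.sub_one_pos]; linarith
    obtain ⟨A, hA, h⟩ := sum_norm_heatPairing_le hpq.symm hq
    refine ⟨A, hA, fun f g hf hg b hb N => ?_⟩
    rw [add_comm]
    refine le_of_eq_of_le (Finset.sum_congr rfl fun j _ => ?_) (h g f hg hf b hb N)
    rw [heatPairing_comm (by positivity) hf.ofReal_integrable hg.ofReal_integrable]

/-- The truncated kernel of the Beurling transform (up to sign). -/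
def beurlingK (a b : ℝ) (z : ℂ) : ℂ := ∫ t in a..b, heatK2 t z

lemma measurable_heatK2 : Measurable (Function.uncurry heatK2) := by
  unfold heatK2 Function.uncurry
  fun_prop

lemma continuousOn_heatK2 (z : ℂ) : ContinuousOn (fun t => heatK2 t z) (Set.Ioi 0) := by
  intro t ht
  have ht' : t ≠ 0 := (Set.mem_Ioi.1 ht).ne'
  refine ContinuousAt.continuousWithinAt ?_
  unfold heatK2
  have h3 : ((Real.pi * t ^ 3 : ℝ) : ℂ) ≠ 0 := by
    have := Real.pi_pos
    exact_mod_cast (by positivity : Real.pi * t ^ 3 ≠ 0)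
  fun_prop (disch := assumption)

lemma norm_heatK2_le_of_le {a t : ℝ} (ha : 0 < a) (h : a ≤ t) (z : ℂ) :
    ‖heatK2 t z‖ ≤ 2 / (Real.pi * a ^ 2) := by
  refine (norm_heatK2_le_const (ha.trans_le h) z).trans ?_
  gcongr

lemma norm_beurlingK_le {a b : ℝ} (ha : 0 < a) (hab : a ≤ b) (z : ℂ) :
    ‖beurlingK a b z‖ ≤ 2 / (Real.pi * a ^ 2) * |b - a| := by
  refine intervalIntegral.norm_integral_le_of_norm_le_const fun t ht => ?_
  rw [Set.uIoc_of_le hab] at ht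
  exact norm_heatK2_le_of_le ha ht.1.le z

lemma continuous_beurlingK {a b : ℝ} (ha : 0 < a) (hab : a ≤ b) : Continuous (beurlingK a b) := by
  refine intervalIntegral.continuous_of_dominated_interval (bound := fun _ => 2 / (Real.pi * a ^ 2))
    (fun z => ?_) (fun z => ?_) intervalIntegrable_const ?_
  · exact (measurable_heatK2.comp (measurable_id.prodMk measurable_const)).aestronglyMeasurable
  · refine ae_of_all _ fun t ht => ?_
    rw [Set.uIoc_of_le hab] at ht
    exact norm_heatK2_le_of_le ha ht.1.le z
  · exact ae_of_all _ fun t _ => continuous_heatK2 t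

lemma continuous_cv {K f : ℂ → ℂ} (hK : Continuous K) {M : ℝ} (hM : ∀ z, ‖K z‖ ≤ M)
    (hf : Integrable f) : Continuous (cv K f) := by
  refine continuous_of_dominated (bound := fun y => M * ‖f y‖)
    (fun x => (integrable_cv_integrand hK hM hf x).aestronglyMeasurable)
    (fun x => ae_of_all _ fun y => ?_) (hf.norm.const_mul M) (ae_of_all _ fun y => by fun_prop)
  rw [norm_mul]; gcongr; exact hM _

lemma norm_cv_le_of_bdd {K f : ℂ → ℂ} {M : ℝ} (hM : ∀ z, ‖K z‖ ≤ M)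
    (hf : Integrable f) (x : ℂ) : ‖cv K f x‖ ≤ M * ∫ y, ‖f y‖ := by
  rw [← integral_const_mul]
  refine norm_integral_le_of_norm_le (hf.norm.const_mul M) (ae_of_all _ fun y => ?_)
  rw [norm_mul]; gcongr; exact hM _

lemma heatPairing_eq_integral_prod {t : ℝ} (ht : 0 < t) {f g : ℂ → ℂ} (hf : Integrable f)
    (hg : Integrable g) :
    heatPairing t f g = ∫ p : ℂ × ℂ, g p.1 * (heatK2 t (p.1 - p.2) * f p.2) ∂(volume.prod volume) := by
  rw [integral_prod _ (integrable_kernel_both (continuous_heatK2 t) (norm_heatK2_le_const ht) hf hg)]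
  unfold heatPairing cv
  simp_rw [← integral_const_mul]

lemma norm_kernel_both_le {K f g : ℂ → ℂ} {M : ℝ} (hM : ∀ z, ‖K z‖ ≤ M) (p : ℂ × ℂ) :
    ‖g p.1 * (K (p.1 - p.2) * f p.2)‖ ≤ M * ‖g p.1 * f p.2‖ := by
  rw [norm_mul, norm_mul, norm_mul]
  have := mul_le_mul_of_nonneg_right (hM (p.1 - p.2))
    (mul_nonneg (norm_nonneg (g p.1)) (norm_nonneg (f p.2)))
  linarith

lemma continuousOn_heatPairing {f g : ℂ → ℂ} (hf : Integrable f) (hg : Integrable g) {a : ℝ}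
    (ha : 0 < a) : ContinuousOn (fun t => heatPairing t f g) (Set.Ici a) := by
  have : ContinuousOn (fun t => ∫ p : ℂ × ℂ, g p.1 * (heatK2 t (p.1 - p.2) * f p.2)
      ∂(volume.prod volume)) (Set.Ici a) := by
    refine continuousOn_of_dominated (bound := fun p => 2 / (Real.pi * a ^ 2) * ‖g p.1 * f p.2‖)
      (fun t ht => ?_) (fun t ht => ae_of_all _ fun p => ?_) ((hg.mul_prod hf).norm.const_mul _)
      (ae_of_all _ fun p => ?_)
    · have ht0 : 0 < t := ha.trans_le ht
      exact (integrable_kernel_both (continuous_heatK2 t) (norm_heatK2_le_const ht0)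
        hf hg).aestronglyMeasurable
    · exact norm_kernel_both_le (norm_heatK2_le_of_le ha ht) p
    · exact continuousOn_const.mul (((continuousOn_heatK2 _).mono fun t ht => ha.trans_le ht).mul
        continuousOn_const)
  refine this.congr fun t ht => heatPairing_eq_integral_prod (ha.trans_le ht) hf hg

lemma integral_heatPairing {a b : ℝ} (ha : 0 < a) (hab : a ≤ b) {f g : ℂ → ℂ} (hf : Integrable f)
    (hg : Integrable g) :
    ∫ t in a..b, heatPairing t f g = ∫ x, g x * cv (beurlingK a b) f x := by
  have h1 : ∫ x, g x * cv (beurlingK a b) f x =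
      ∫ p : ℂ × ℂ, g p.1 * (beurlingK a b (p.1 - p.2) * f p.2) ∂(volume.prod volume) := by
    rw [integral_prod _ (integrable_kernel_both (continuous_beurlingK ha hab) (norm_beurlingK_le ha hab) hf hg)]
    unfold cv
    simp_rw [← integral_const_mul]
  rw [h1]
  have h2 : ∫ t in a..b, heatPairing t f g =
      ∫ t in a..b, ∫ p : ℂ × ℂ, g p.1 * (heatK2 t (p.1 - p.2) * f p.2) ∂(volume.prod volume) := by
    refine intervalIntegral.integral_congr fun t ht => ?_
    rw [Set.uIcc_of_le hab] at ht
    exact heatPairing_eq_integral_prod (ha.trans_le ht.1) hf hg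
  rw [h2, intervalIntegral.integral_of_le hab, integral_integral_swap]
  · refine integral_congr_ae (ae_of_all _ fun p => ?_)
    simp only
    rw [integral_const_mul, integral_mul_const, beurlingK, intervalIntegral.integral_of_le hab]
  · have hi : Integrable (fun q : ℝ × (ℂ × ℂ) => 2 / (Real.pi * a ^ 2) * ‖g q.2.1 * f q.2.2‖)
        ((volume.restrict (Set.Ioc a b)).prod (volume.prod volume)) :=
      ((hg.mul_prod hf).norm.const_mul (2 / (Real.pi * a ^ 2))).comp_snd _
    refine hi.mono' ?_ ?_
    · have m1 : AEStronglyMeasurable (fun q : ℝ × (ℂ × ℂ) => g q.2.1)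
          ((volume.restrict (Set.Ioc a b)).prod (volume.prod volume)) :=
        AEStronglyMeasurable.comp_snd (f := fun p : ℂ × ℂ => g p.1) hg.aestronglyMeasurable.comp_fst
      have m2 : AEStronglyMeasurable (fun q : ℝ × (ℂ × ℂ) => f q.2.2)
          ((volume.restrict (Set.Ioc a b)).prod (volume.prod volume)) :=
        AEStronglyMeasurable.comp_snd (f := fun p : ℂ × ℂ => f p.2) hf.aestronglyMeasurable.comp_snd
      have m0 : Measurable fun q : ℝ × (ℂ × ℂ) => (q.1, q.2.1 - q.2.2) := by fun_prop
      have m3 : Measurable (fun q : ℝ × (ℂ × ℂ) => Function.uncurry heatK2 (q.1, q.2.1 - q.2.2)) :=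
        measurable_heatK2.comp m0
      exact m1.mul (m3.aestronglyMeasurable.mul m2)
    · have : ∀ᵐ q : ℝ × (ℂ × ℂ) ∂((volume.restrict (Set.Ioc a b)).prod (volume.prod volume)),
          q.1 ∈ Set.Ioc a b :=
        Measure.quasiMeasurePreserving_fst.ae (ae_restrict_mem measurableSet_Ioc)
      filter_upwards [this] with q hq
      exact norm_kernel_both_le (norm_heatK2_le_of_le ha hq.1.le) q.2

lemma integral_dyadic {Q : ℝ → ℂ} {a : ℝ} (ha : 0 < a) (hQ : ContinuousOn Q (Set.Ici a)) (N : ℕ) :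
    ∫ t in a..(a * 2 ^ N), Q t =
      ∫ t in a..(2 * a), ∑ j ∈ Finset.range N, (2 ^ j : ℝ) • Q (2 ^ j * t) := by
  have hle : ∀ j : ℕ, a ≤ a * 2 ^ j := fun j => le_mul_of_one_le_right ha.le (one_le_pow₀ (by norm_num))
  have hi : ∀ {c d : ℝ}, a ≤ c → a ≤ d → IntervalIntegrable Q volume c d := fun hc hd =>
    (hQ.mono fun x hx => (le_min hc hd).trans hx.1).intervalIntegrable
  have h1 := intervalIntegral.sum_integral_adjacent_intervals (f := Q) (μ := volume)
    (a := fun j : ℕ => a * 2 ^ j) (n := N) (fun k _ => hi (hle k) (hle (k + 1)))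
  rw [pow_zero, mul_one] at h1
  rw [← h1, intervalIntegral.integral_finsetSum]
  · refine Finset.sum_congr rfl fun j _ => ?_
    rw [intervalIntegral.integral_smul, intervalIntegral.smul_integral_comp_mul_left]
    congr 1 <;> ring
  · intro j _
    have hc : ContinuousOn (fun t : ℝ => 2 ^ j * t) (Set.uIcc a (2 * a)) := by fun_prop
    refine ContinuousOn.intervalIntegrable (ContinuousOn.const_smul (hQ.comp hc ?_) (2 ^ j : ℝ))
    intro t ht
    rw [Set.uIcc_of_le (by linarith)] at ht
    have : (1 : ℝ) ≤ 2 ^ j := one_le_pow₀ (by norm_num)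
    exact ht.1.trans (le_mul_of_one_le_left (ha.le.trans ht.1) this)

lemma exists_norm_integral_cv_beurlingK_le {p q : ℝ} (hpq : p.HolderConjugate q) :
    ∃ A > 0, ∀ f g : ℂ → ℝ, Tame f → Tame g → ∀ a > 0, ∀ N : ℕ,
      ‖∫ x, (g x : ℂ) * cv (beurlingK a (a * 2 ^ N)) (fun x => (f x : ℂ)) x‖ ≤
      A * ((∫ x, f x ^ p) + ∫ x, g x ^ q) := by
  obtain ⟨A, hA, h⟩ := exists_sum_norm_heatPairing_le hpq
  refine ⟨7 * A, by positivity, fun f g hf hg a ha N => ?_⟩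
  have hle : a ≤ a * 2 ^ N := le_mul_of_one_le_right ha.le (one_le_pow₀ (by norm_num))
  rw [← integral_heatPairing ha hle hf.ofReal_integrable hg.ofReal_integrable,
    integral_dyadic ha (continuousOn_heatPairing hf.ofReal_integrable hg.ofReal_integrable ha)]
  set B := (∫ x, f x ^ p) + ∫ x, g x ^ q with hB
  have hfp : 0 ≤ ∫ x, f x ^ p := integral_nonneg fun x => Real.rpow_nonneg (hf.nonneg x) p
  have hgq : 0 ≤ ∫ x, g x ^ q := integral_nonneg fun x => Real.rpow_nonneg (hg.nonneg x) q
  have hB0 : 0 ≤ B := by positivity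
  calc _ ≤ 7 * A * B / a * |2 * a - a| := by
        refine intervalIntegral.norm_integral_le_of_norm_le_const fun t ht => ?_
        rw [Set.uIoc_of_le (by linarith)] at ht
        have ht0 : 0 < t := ha.trans ht.1
        have h1 := h f g hf hg (t / 7) (by positivity) N
        calc _ ≤ ∑ j ∈ Finset.range N, ‖(2 ^ j : ℝ) • heatPairing (2 ^ j * t) (fun x => (f x : ℂ))
              (fun x => (g x : ℂ))‖ := norm_sum_le _ _
          _ = (7 / t) * ∑ j ∈ Finset.range N, ‖((t / 7 * 2 ^ j : ℝ) : ℂ) *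
              heatPairing (7 * (t / 7 * 2 ^ j)) (fun x => (f x : ℂ)) (fun x => (g x : ℂ))‖ := by
              rw [Finset.mul_sum]
              refine Finset.sum_congr rfl fun j _ => ?_
              rw [norm_smul, norm_mul, Complex.norm_real, Real.norm_of_nonneg (by positivity),
                Real.norm_of_nonneg (by positivity), show 7 * (t / 7 * 2 ^ j) = 2 ^ j * t by ring]
              field_simp
          _ ≤ (7 / t) * (A * B) := by gcongr
          _ ≤ (7 / a) * (A * B) := by
              gcongr; exact ht.1.le
          _ = _ := by ring
    _ = _ := by rw [show 2 * a - a = a by ring, abs_of_pos ha]; field_simp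

lemma exists_integral_rpow_le_of_forall {p q A : ℝ} (hpq : p.HolderConjugate q) (hA : 0 < A) :
    ∃ C > 0, ∀ F X : ℝ, (∀ l > 0, l * X ≤ A * (F + l ^ q * X)) → X ≤ C * F := by
  have hq : 0 < q - 1 := hpq.symm.sub_one_pos
  set l : ℝ := (1 / (2 * A)) ^ (1 / (q - 1)) with hl
  have hl0 : 0 < l := by positivity
  have hlq : A * l ^ q = l / 2 := by
    have h1 : l ^ (q - 1) = 1 / (2 * A) := by
      rw [hl, ← Real.rpow_mul (by positivity), one_div_mul_cancel hq.ne', Real.rpow_one]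
    rw [show q = (q - 1) + 1 by ring, Real.rpow_add_one hl0.ne', h1]
    field_simp
  refine ⟨2 * A / l, by positivity, fun F X h => ?_⟩
  have := h l hl0
  rw [div_mul_eq_mul_div, le_div_iff₀ hl0]
  have h2 : A * (F + l ^ q * X) = A * F + (A * l ^ q) * X := by ring
  rw [h2, hlq] at this
  linarith

lemma exists_integral_max_re_rpow_le {p q : ℝ} (hpq : p.HolderConjugate q) :
    ∃ C > 0, ∀ f : ℂ → ℝ, Tame f → ∀ a > 0, ∀ (N : ℕ) (R : ℝ) (θ : ℂ), ‖θ‖ = 1 →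
      ∫ x in ball (0 : ℂ) R, max (θ * cv (beurlingK a (a * 2 ^ N)) (fun x => (f x : ℂ)) x).re 0 ^ p ≤
      C * ∫ x, f x ^ p := by
  obtain ⟨A, hA, h⟩ := exists_norm_integral_cv_beurlingK_le hpq
  obtain ⟨C, hC, h'⟩ := exists_integral_rpow_le_of_forall hpq hA
  refine ⟨C, hC, fun f hf a ha N R θ hθ => h' _ _ fun l hl => ?_⟩
  have hle : a ≤ a * 2 ^ N := le_mul_of_one_le_right ha.le (one_le_pow₀ (by norm_num))
  have hp1 : 0 < p - 1 := hpq.sub_one_pos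
  have hp0 : 0 < p := hpq.pos
  have hq0 : 0 < q := hpq.symm.pos
  set b := cv (beurlingK a (a * 2 ^ N)) (fun x => (f x : ℂ)) with hb
  have hbc : Continuous b := continuous_cv (continuous_beurlingK ha hle) (norm_beurlingK_le ha hle)
    hf.ofReal_integrable
  obtain ⟨M, hM⟩ : ∃ M, ∀ x, ‖b x‖ ≤ M := ⟨_, norm_cv_le_of_bdd (norm_beurlingK_le ha hle)
    hf.ofReal_integrable⟩
  have hM0 : 0 ≤ M := (norm_nonneg _).trans (hM 0)
  set ρ : ℂ → ℝ := fun x => max (θ * b x).re 0 with hρ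
  have hρc : Continuous ρ := by fun_prop
  have hρ0 : ∀ x, 0 ≤ ρ x := fun x => le_max_right _ _
  have hρM : ∀ x, ρ x ≤ M := fun x => max_le (by
    refine (re_le_norm _).trans ?_
    rw [norm_mul, hθ, one_mul]; exact hM x) hM0
  set g : ℂ → ℝ := (ball (0 : ℂ) R).indicator fun x => l * ρ x ^ (p - 1) with hg
  have hgc : Continuous fun x => l * ρ x ^ (p - 1) :=
    continuous_const.mul (hρc.rpow_const fun x => Or.inr hp1.le)
  have hg0 : ∀ x, 0 ≤ g x := Set.indicator_nonneg fun x _ => by have := hρ0 x; positivity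
  have hgt : Tame g := by
    refine ⟨hg0, ?_, l * M ^ (p - 1), ?_⟩
    · rw [hg, integrable_indicator_iff measurableSet_ball]
      exact (hgc.continuousOn.integrableOn_compact (isCompact_closedBall 0 R)).mono_set
        ball_subset_closedBall
    · intro x
      refine Set.indicator_apply_le' (fun _ => ?_) (fun _ => by positivity)
      have := hρ0 x
      have := hρM x
      gcongr
  have key := h f g hf hgt a ha N
  rw [← hb] at key
  have e1 : ∫ x, g x ^ q = l ^ q * ∫ x in ball (0 : ℂ) R, ρ x ^ p := by
    rw [← integral_const_mul, ← integral_indicator measurableSet_ball]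
    refine integral_congr_ae (ae_of_all _ fun x => ?_)
    by_cases hx : x ∈ ball (0 : ℂ) R
    · simp only [hg, Set.indicator_of_mem hx]
      have := hρ0 x
      rw [Real.mul_rpow hl.le (by positivity), ← Real.rpow_mul this, hpq.sub_one_mul_conj]
    · simp only [hg, Set.indicator_of_notMem hx]
      exact Real.zero_rpow hq0.ne'
  have e2 : l * ∫ x in ball (0 : ℂ) R, ρ x ^ p = (θ * ∫ x, (g x : ℂ) * b x).re := by
    rw [← integral_const_mul, ← integral_const_mul, ← integral_indicator measurableSet_ball]
    have hi : Integrable fun x => θ * ((g x : ℂ) * b x) :=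
      (hgt.ofReal_integrable.mul_bdd (c := M) hbc.aestronglyMeasurable (ae_of_all _ hM)).const_mul θ
    have hre := integral_re hi
    simp only [RCLike.re_to_complex] at hre
    rw [← hre]
    refine integral_congr_ae (ae_of_all _ fun x => ?_)
    by_cases hx : x ∈ ball (0 : ℂ) R
    · simp only [hg, Set.indicator_of_mem hx]
      rw [mul_left_comm, re_ofReal_mul]
      rcases le_total (θ * b x).re 0 with h0 | h0
      · have : ρ x = 0 := max_eq_right h0
        rw [this, Real.zero_rpow hp0.ne', Real.zero_rpow hp1.ne']; simp
      · have : ρ x = (θ * b x).re := max_eq_left h0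
        rw [← this]
        rcases (hρ0 x).eq_or_lt with h1 | h1
        · rw [← h1, Real.zero_rpow hp0.ne']; simp
        · rw [mul_assoc, ← Real.rpow_add_one h1.ne', sub_add_cancel]
    · simp [hg, Set.indicator_of_notMem hx]
  rw [e2, ← e1]
  refine ((re_le_norm _).trans ?_).trans key
  rw [norm_mul, hθ, one_mul]

lemma sum_conj_mul_max_re (z : ℂ) :
    ∑ i : Fin 4, (starRingEnd ℂ) (I ^ (i : ℕ)) * (max (I ^ (i : ℕ) * z).re 0 : ℝ) = z := by
  have h3 : (-I) ^ 3 = I := by rw [neg_pow, pow_succ I, I_sq]; norm_num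
  have h4 : I ^ 3 = -I := by rw [pow_succ, I_sq]; simp
  have h1 : max z.re 0 - max (-z.re) 0 = z.re := by
    rcases le_total z.re 0 with h | h <;> simp [h]
  have h2 : max z.im 0 - max (-z.im) 0 = z.im := by
    rcases le_total z.im 0 with h | h <;> simp [h]
  apply Complex.ext
  · simp [Fin.sum_univ_four, h3, h4]; linarith
  · simp [Fin.sum_univ_four, h3, h4]; linarith

lemma norm_le_sum_max_re (z : ℂ) : ‖z‖ ≤ ∑ i : Fin 4, max (I ^ (i : ℕ) * z).re 0 := by
  nth_rewrite 1 [← sum_conj_mul_max_re z]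
  refine (norm_sum_le _ _).trans (le_of_eq (Finset.sum_congr rfl fun i _ => ?_))
  rw [norm_mul, RCLike.norm_conj, norm_pow, norm_I, one_pow, one_mul, Complex.norm_real,
    Real.norm_of_nonneg (le_max_right _ _)]

lemma max_re_le_norm (i : ℕ) (z : ℂ) : max (I ^ i * z).re 0 ≤ ‖z‖ := by
  refine max_le ((re_le_norm _).trans ?_) (norm_nonneg _)
  rw [norm_mul, norm_pow, norm_I, one_pow, one_mul]

lemma exists_integral_norm_cv_rpow_le {p : ℝ} (hp : 1 < p) :
    ∃ C > 0, ∀ w : ℂ → ℂ, Continuous w → Integrable w → (∃ M, ∀ x, ‖w x‖ ≤ M) →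
      ∀ a > 0, ∀ (N : ℕ) (R : ℝ),
      ∫ x in ball (0 : ℂ) R, ‖cv (beurlingK a (a * 2 ^ N)) w x‖ ^ p ≤ C * ∫ x, ‖w x‖ ^ p := by
  have hpq := Real.HolderConjugate.conjExponent hp
  have hp0 : 0 < p := hpq.pos
  obtain ⟨C, hC, h⟩ := exists_integral_max_re_rpow_le hpq
  refine ⟨16 ^ (p - 1) * (16 * C), by positivity, fun w hw hwi ⟨M, hM⟩ a ha N R => ?_⟩
  have hle : a ≤ a * 2 ^ N := le_mul_of_one_le_right ha.le (one_le_pow₀ (by norm_num))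
  set K := beurlingK a (a * 2 ^ N) with hK
  have hKc := continuous_beurlingK ha hle
  have hKb := norm_beurlingK_le ha hle
  rw [← hK] at hKc hKb
  have hnt : Tame fun x => ‖w x‖ := ⟨fun x => norm_nonneg _, hwi.norm, M, hM⟩
  let f : Fin 4 → ℂ → ℝ := fun i x => max (I ^ (i : ℕ) * w x).re 0
  have hfn : ∀ i x, f i x ≤ ‖w x‖ := fun i x => max_re_le_norm i (w x)
  have hf0 : ∀ i x, 0 ≤ f i x := fun i x => le_max_right _ _
  have hft : ∀ i, Tame (f i) := fun i => by
    refine ⟨hf0 i, hwi.norm.mono' (by fun_prop) (ae_of_all _ fun x => ?_),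
      M, fun x => (hfn i x).trans (hM x)⟩
    rw [Real.norm_of_nonneg (hf0 i x)]; exact hfn i x
  have hcv : ∀ x, cv K w x = ∑ i : Fin 4, (starRingEnd ℂ) (I ^ (i : ℕ)) * cv K (fun x => (f i x : ℂ)) x := by
    intro x
    unfold cv
    simp_rw [← integral_const_mul]
    rw [← integral_finsetSum]
    · refine integral_congr_ae (ae_of_all _ fun y => ?_)
      simp only
      nth_rewrite 1 [← sum_conj_mul_max_re (w y)]
      rw [Finset.mul_sum]
      exact Finset.sum_congr rfl fun i _ => by simp only [f]; ring
    · exact fun i _ => (integrable_cv_integrand hKc hKb (hft i).ofReal_integrable x).const_mul _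
  let ρ : Fin 4 × Fin 4 → ℂ → ℝ := fun i x =>
    max (I ^ (i.2 : ℕ) * cv K (fun x => (f i.1 x : ℂ)) x).re 0
  have hρ0 : ∀ i x, 0 ≤ ρ i x := fun i x => le_max_right _ _
  have hρc : ∀ i, Continuous (ρ i) := fun i => by
    have := continuous_cv hKc hKb (hft i.1).ofReal_integrable
    fun_prop
  have hρp : ∀ i, IntegrableOn (fun x => ρ i x ^ p) (ball (0 : ℂ) R) := fun i =>
    (((hρc i).rpow_const fun x => Or.inr hp0.le).continuousOn.integrableOn_compact
      (isCompact_closedBall 0 R)).mono_set ball_subset_closedBall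
  have hle1 : ∀ x, ‖cv K w x‖ ≤ ∑ i, ρ i x := fun x => by
    rw [hcv, Fintype.sum_prod_type]
    refine (norm_sum_le _ _).trans (Finset.sum_le_sum fun i _ => ?_)
    rw [norm_mul, RCLike.norm_conj, norm_pow, norm_I, one_pow, one_mul]
    exact norm_le_sum_max_re _
  have hle2 : ∀ x, ‖cv K w x‖ ^ p ≤ 16 ^ (p - 1) * ∑ i, ρ i x ^ p := fun x => by
    refine (Real.rpow_le_rpow (norm_nonneg _) (hle1 x) hp0.le).trans ?_
    have := Real.rpow_sum_le_const_mul_sum_rpow_of_nonneg (s := Finset.univ) (f := fun i => ρ i x) hp.le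
      (fun i _ => hρ0 i x)
    simpa using this
  have hint : IntegrableOn (fun x => 16 ^ (p - 1) * ∑ i, ρ i x ^ p) (ball (0 : ℂ) R) :=
    (integrable_finsetSum _ fun i _ => hρp i).const_mul _
  calc _ ≤ ∫ x in ball (0 : ℂ) R, 16 ^ (p - 1) * ∑ i, ρ i x ^ p :=
        integral_mono_of_nonneg (ae_of_all _ fun x => by positivity) hint (ae_of_all _ hle2)
    _ = 16 ^ (p - 1) * ∑ i, ∫ x in ball (0 : ℂ) R, ρ i x ^ p := by
        rw [integral_const_mul, integral_finsetSum _ fun i _ => hρp i]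
    _ ≤ 16 ^ (p - 1) * ∑ i : Fin 4 × Fin 4, C * ∫ x, ‖w x‖ ^ p := by
        gcongr with i
        refine (h (f i.1) (hft i.1) a ha N R (I ^ (i.2 : ℕ)) (by simp)).trans ?_
        gcongr
        · exact (hft i.1).integrable_rpow hp
        · exact hnt.integrable_rpow hp
        · intro x
          exact Real.rpow_le_rpow (hf0 _ x) (hfn _ x) hp0.le
    _ = _ := by simp; ring

lemma locallyIntegrable_inv : LocallyIntegrable (fun z : ℂ => z⁻¹) := by
  refine locallyIntegrable_of_norm_le_rpow (C := 1) (α := 1) (by simp) (by simp)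
    (ae_of_all _ fun z => ?_) measurable_inv.aestronglyMeasurable
  rw [norm_inv, one_mul, Real.rpow_neg (norm_nonneg _), Real.rpow_one]

lemma integrable_inv_mul {g : ℂ → ℂ} (hg : Continuous g) (hc : HasCompactSupport g) (x : ℂ) :
    Integrable fun t => t⁻¹ * g (x - t) :=
  hc.convolutionExists_right (ContinuousLinearMap.mul ℝ ℂ) locallyIntegrable_inv hg x

lemma cauchyT_eq (w : ℂ → ℂ) (z : ℂ) :
    cauchyT w z = (1 / (Real.pi : ℂ)) * ∫ t : ℂ, t⁻¹ * w (z - t) := by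
  unfold cauchyT
  rw [← integral_sub_left_eq_self _ _ z, neg_mul, ← mul_neg, ← integral_neg]
  congr 2
  ext t
  rw [sub_sub_cancel_left, div_neg, neg_neg, div_eq_mul_inv, mul_comm]

lemma hasFDerivAt_cauchyT {w : ℂ → ℂ} (hw : ContDiff ℝ 1 w) (hc : HasCompactSupport w) (z : ℂ) :
    ∃ L : ℂ →L[ℝ] ℂ, HasFDerivAt (cauchyT w) L z ∧
      ∀ v, L v = (1 / (Real.pi : ℂ)) * ∫ t : ℂ, t⁻¹ * fderiv ℝ w (z - t) v := by
  have h := hc.hasFDerivAt_convolution_right (ContinuousLinearMap.mul ℝ ℂ) locallyIntegrable_inv hw z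
  have h2 := h.const_mul (1 / (Real.pi : ℂ))
  refine ⟨_, h2.congr_of_eventuallyEq (Eventually.of_forall fun x => ?_), fun v => ?_⟩
  · rw [cauchyT_eq]; rfl
  · rw [smul_apply, convolution_precompR_apply _ locallyIntegrable_inv
      (hc.fderiv ℝ) (hw.continuous_fderiv one_ne_zero)]
    rfl

lemma continuous_wz {w : ℂ → ℂ} (hw : ContDiff ℝ 1 w) : Continuous (wz w) := by
  have := hw.continuous_fderiv one_ne_zero
  unfold wz; fun_prop

lemma hasCompactSupport_wz {w : ℂ → ℂ} (hc : HasCompactSupport w) : HasCompactSupport (wz w) := by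
  refine (hc.fderiv ℝ).mono fun x hx h => hx ?_
  simp [wz, h]

lemma wz_cauchyT {w : ℂ → ℂ} (hw : ContDiff ℝ 1 w) (hc : HasCompactSupport w) (z : ℂ) :
    wz (cauchyT w) z = (1 / (Real.pi : ℂ)) * ∫ t : ℂ, t⁻¹ * wz w (z - t) := by
  obtain ⟨L, hL, hv⟩ := hasFDerivAt_cauchyT hw hc z
  have hcf := hw.continuous_fderiv one_ne_zero
  have hi : ∀ v, Integrable fun t : ℂ => t⁻¹ * fderiv ℝ w (z - t) v := fun v =>
    integrable_inv_mul (g := fun y => fderiv ℝ w y v) (by fun_prop)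
      ((hc.fderiv ℝ).mono fun x hx h => hx (by simp [h])) z
  rw [wz, hL.fderiv, hv, hv]
  have : ∫ t : ℂ, t⁻¹ * wz w (z - t) = (1 / 2) * ((∫ t : ℂ, t⁻¹ * fderiv ℝ w (z - t) 1) -
      I * ∫ t : ℂ, t⁻¹ * fderiv ℝ w (z - t) I) := by
    rw [← integral_const_mul, ← integral_sub (hi 1) ((hi I).const_mul I), ← integral_const_mul]
    refine integral_congr_ae (ae_of_all _ fun t => ?_)
    simp only [wz]; ring
  rw [this]; ring

lemma integral_wz_mul {f g : ℂ → ℂ} (hf : ContDiff ℝ 1 f) (hg : ContDiff ℝ 1 g)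
    (hc : HasCompactSupport g) : ∫ x, wz f x * g x = -∫ x, f x * wz g x := by
  have hcf := hf.continuous_fderiv one_ne_zero
  have hcg := hg.continuous_fderiv one_ne_zero
  have cf := hf.continuous
  have cg := hg.continuous
  have i1 : ∀ v, Integrable fun x => fderiv ℝ f x v * g x := fun v =>
    Continuous.integrable_of_hasCompactSupport (by fun_prop) hc.mul_left
  have i2 : ∀ v, Integrable fun x => f x * fderiv ℝ g x v := fun v =>
    Continuous.integrable_of_hasCompactSupport (by fun_prop)
      (HasCompactSupport.mul_left (f := f) ((hc.fderiv ℝ).mono fun x hx h => hx (by simp [h])))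
  have i3 : Integrable fun x => f x * g x :=
    Continuous.integrable_of_hasCompactSupport (by fun_prop) hc.mul_left
  have key : ∀ v, ∫ x, f x * fderiv ℝ g x v = -∫ x, fderiv ℝ f x v * g x := fun v =>
    integral_mul_fderiv_eq_neg_fderiv_mul_of_integrable (i1 v) (i2 v) i3
      (fun x _ => (hf.differentiable one_ne_zero).differentiableAt)
      (fun x _ => (hg.differentiable one_ne_zero).differentiableAt)
  have e1 : ∫ x, wz f x * g x = (1 / 2) * ((∫ x, fderiv ℝ f x 1 * g x) -
      I * ∫ x, fderiv ℝ f x I * g x) := by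
    rw [← integral_const_mul, ← integral_sub (i1 1) ((i1 I).const_mul I), ← integral_const_mul]
    refine integral_congr_ae (ae_of_all _ fun t => ?_)
    simp only [wz]; ring
  have e2 : ∫ x, f x * wz g x = (1 / 2) * ((∫ x, f x * fderiv ℝ g x 1) -
      I * ∫ x, f x * fderiv ℝ g x I) := by
    rw [← integral_const_mul, ← integral_sub (i2 1) ((i2 I).const_mul I), ← integral_const_mul]
    refine integral_congr_ae (ae_of_all _ fun t => ?_)
    simp only [wz]; ring
  rw [e1, e2, key, key]; ring

lemma wz_comp_sub_left {w : ℂ → ℂ} (hw : ContDiff ℝ 1 w) (x y : ℂ) :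
    wz (fun y => w (x - y)) y = -wz w (x - y) := by
  have h : HasFDerivAt (fun y => w (x - y)) _ y :=
    ((hw.differentiable one_ne_zero) (x - y)).hasFDerivAt.comp y ((hasFDerivAt_id y).const_sub x)
  rw [wz, h.fderiv, wz]
  simp
  ring

/-- The first Wirtinger derivative `∂/∂z` of `heatK t`. -/
def heatK1 (t : ℝ) (z : ℂ) : ℂ :=
  -((starRingEnd ℂ) z * (Real.exp (-t⁻¹ * ‖z‖ ^ 2) : ℂ) / (Real.pi * t ^ 2 : ℝ))

lemma contDiff_heatK1 (t : ℝ) : ContDiff ℝ 1 (heatK1 t) := by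
  unfold heatK1
  have h1 : ContDiff ℝ 1 (starRingEnd ℂ : ℂ → ℂ) := conjCLE.contDiff
  have h2 : ContDiff ℝ 1 fun z : ℂ => (Real.exp (-t⁻¹ * ‖z‖ ^ 2) : ℂ) :=
    ofRealCLM.contDiff.comp (Real.contDiff_exp.comp (contDiff_const.mul (contDiff_norm_sq ℝ)))
  exact ((h1.mul h2).div_const _).neg

lemma wz_heatK1 {t : ℝ} (ht : t ≠ 0) (z : ℂ) : wz (heatK1 t) z = heatK2 t z := by
  have h1 : HasFDerivAt (starRingEnd ℂ : ℂ → ℂ) (conjCLE : ℂ →L[ℝ] ℂ) z := conjCLE.hasFDerivAt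
  have h2 := (hasStrictFDerivAt_norm_sq z).hasFDerivAt
  have h3 := ofRealCLM.hasFDerivAt.comp z ((h2.const_mul (-t⁻¹)).exp)
  have h4 := ((h1.mul h3).mul_const (((Real.pi * t ^ 2 : ℝ) : ℂ)⁻¹)).neg
  have h5 : HasFDerivAt (heatK1 t) _ z := h4
  rw [wz, h5.fderiv]
  have hpi : (Real.pi : ℂ) ≠ 0 := by exact_mod_cast Real.pi_ne_zero
  have htc : (t : ℂ) ≠ 0 := by exact_mod_cast ht
  have hz : (starRingEnd ℂ) z = z.re - z.im * I := by
    apply Complex.ext <;> simp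
  simp [heatK2, hz]
  field_simp
  ring_nf
  simp only [I_sq]
  ring

lemma integral_intervalIntegral_mul {k : ℝ → ℂ → ℂ} (hk : Measurable (Function.uncurry k))
    {a b M : ℝ} (hab : a ≤ b) (hM : ∀ t ∈ Set.Ioc a b, ∀ y, ‖k t y‖ ≤ M) {F : ℂ → ℂ}
    (hF : Integrable F) :
    ∫ y, (∫ t in a..b, k t y) * F y = ∫ t in a..b, ∫ y, k t y * F y := by
  simp_rw [intervalIntegral.integral_of_le hab, ← integral_mul_const]
  refine integral_integral_swap ?_
  refine (hF.comp_fst (volume.restrict (Set.Ioc a b))).bdd_mul (c := M)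
    (f := fun q : ℂ × ℝ => Function.uncurry k (q.2, q.1))
    (hk.comp measurable_swap).aestronglyMeasurable ?_
  exact (Measure.quasiMeasurePreserving_snd.ae (ae_restrict_mem measurableSet_Ioc)).mono
    fun q hq => hM q.2 hq q.1

lemma measurable_heatK1 : Measurable (Function.uncurry heatK1) := by
  have : Measurable (starRingEnd ℂ : ℂ → ℂ) := continuous_conj.measurable
  unfold heatK1 Function.uncurry
  fun_prop

lemma norm_heatK1_le {t : ℝ} (ht : 0 < t) (z : ℂ) :
    ‖heatK1 t z‖ ≤ (1 + t) / (Real.pi * t ^ 2) := by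
  have hpi := Real.pi_pos
  unfold heatK1
  rw [norm_neg, norm_div, norm_mul, RCLike.norm_conj, norm_real, norm_real, Real.norm_of_nonneg
    (Real.exp_pos _).le, Real.norm_of_nonneg (by positivity : 0 ≤ Real.pi * t ^ 2)]
  gcongr
  rw [neg_mul, Real.exp_neg, ← div_eq_mul_inv, div_le_iff₀ (Real.exp_pos _)]
  have h1 : t⁻¹ * ‖z‖ ^ 2 + 1 ≤ Real.exp (t⁻¹ * ‖z‖ ^ 2) := Real.add_one_le_exp _
  have h2 : (1 + t) * (t⁻¹ * ‖z‖ ^ 2 + 1) = t⁻¹ * ‖z‖ ^ 2 + 1 + ‖z‖ ^ 2 + t := by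
    field_simp; ring
  have h3 : (1 + t) * (t⁻¹ * ‖z‖ ^ 2 + 1) ≤ (1 + t) * Real.exp (t⁻¹ * ‖z‖ ^ 2) := by gcongr
  have h4 : 0 ≤ t⁻¹ * ‖z‖ ^ 2 := by positivity
  nlinarith [sq_nonneg (‖z‖ - 1)]

lemma intervalIntegral_heatK1 {a b : ℝ} (ha : 0 < a) (hab : a ≤ b) {y : ℂ} (hy : y ≠ 0) :
    ∫ t in a..b, heatK1 t y = -(1 / (Real.pi : ℂ)) * y⁻¹ *
      ((Real.exp (-b⁻¹ * ‖y‖ ^ 2) - Real.exp (-a⁻¹ * ‖y‖ ^ 2) : ℝ) : ℂ) := by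
  have hpi : (Real.pi : ℂ) ≠ 0 := by exact_mod_cast Real.pi_ne_zero
  have hpos : ∀ t ∈ Set.uIcc a b, 0 < t := fun t ht => by
    rw [Set.uIcc_of_le hab] at ht; exact ha.trans_le ht.1
  rw [intervalIntegral.integral_eq_sub_of_hasDerivAt
    (f := fun t => -(1 / (Real.pi : ℂ)) * y⁻¹ * ((Real.exp (-t⁻¹ * ‖y‖ ^ 2) : ℝ) : ℂ))]
  · push_cast; ring
  · intro t ht
    have ht0 : t ≠ 0 := (hpos t ht).ne'
    have htc : (t : ℂ) ≠ 0 := by exact_mod_cast ht0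
    have h1 := ((((hasDerivAt_inv ht0).fun_neg).mul_const (‖y‖ ^ 2)).exp).ofReal_comp
    refine (h1.const_mul (-(1 / (Real.pi : ℂ)) * y⁻¹)).congr_deriv ?_
    unfold heatK1
    have h2 : (starRingEnd ℂ) y = y⁻¹ * ((‖y‖ ^ 2 : ℝ) : ℂ) := by
      rw [ofReal_pow, ← conj_mul', mul_comm, mul_inv_cancel_right₀ hy]
    rw [h2]
    push_cast
    field_simp
  · refine ContinuousOn.intervalIntegrable fun t ht => ContinuousAt.continuousWithinAt ?_
    have ht0 : t ≠ 0 := (hpos t ht).ne'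
    have h3 : ((Real.pi * t ^ 2 : ℝ) : ℂ) ≠ 0 := by
      exact_mod_cast mul_ne_zero Real.pi_ne_zero (pow_ne_zero 2 ht0)
    unfold heatK1
    fun_prop (disch := assumption)

lemma cv_beurlingK_eq {a b : ℝ} (ha : 0 < a) (hab : a ≤ b) {w : ℂ → ℂ} (hw : ContDiff ℝ 1 w)
    (hc : HasCompactSupport w) (x : ℂ) :
    cv (beurlingK a b) w x = ∫ y, -(1 / (Real.pi : ℂ)) * (y⁻¹ * wz w (x - y)) *
      ((Real.exp (-b⁻¹ * ‖y‖ ^ 2) - Real.exp (-a⁻¹ * ‖y‖ ^ 2) : ℝ) : ℂ) := by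
  have hpi := Real.pi_pos
  have hwx : ContDiff ℝ 1 fun y => w (x - y) := hw.comp (contDiff_const.sub contDiff_id)
  have hcx : HasCompactSupport fun y => w (x - y) := hc.comp_homeomorph (Homeomorph.subLeft x)
  have hiw : Integrable w := hw.continuous.integrable_of_hasCompactSupport hc
  have hiz : Integrable (wz w) :=
    (continuous_wz hw).integrable_of_hasCompactSupport (hasCompactSupport_wz hc)
  calc cv (beurlingK a b) w x = ∫ y, beurlingK a b y * w (x - y) := by
        unfold cv
        rw [← integral_sub_left_eq_self _ _ x]
        simp only [sub_sub_cancel]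
    _ = ∫ t in a..b, ∫ y, heatK2 t y * w (x - y) :=
        integral_intervalIntegral_mul measurable_heatK2 hab
          (fun t ht y => norm_heatK2_le_of_le ha ht.1.le y) (hiw.comp_sub_left x)
    _ = ∫ t in a..b, ∫ y, heatK1 t y * wz w (x - y) := by
        refine intervalIntegral.integral_congr fun t ht => ?_
        rw [Set.uIcc_of_le hab] at ht
        have ht0 : t ≠ 0 := (ha.trans_le ht.1).ne'
        have h := integral_wz_mul (contDiff_heatK1 t) hwx hcx
        simp only [wz_heatK1 ht0, wz_comp_sub_left hw, mul_neg, integral_neg, neg_neg] at h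
        exact h
    _ = ∫ y, (∫ t in a..b, heatK1 t y) * wz w (x - y) := by
        refine (integral_intervalIntegral_mul measurable_heatK1 hab
          (M := (1 + b) / (Real.pi * a ^ 2)) (fun t ht y => ?_) (hiz.comp_sub_left x)).symm
        refine (norm_heatK1_le (ha.trans ht.1) y).trans ?_
        have := ht.1
        have := ht.2
        have : 0 ≤ 1 + b := by linarith
        gcongr
    _ = _ := by
        refine integral_congr_ae ?_
        have h0 : ∀ᵐ y : ℂ, y ≠ 0 := by simp [ae_iff]
        filter_upwards [h0] with y hy
        rw [intervalIntegral_heatK1 ha hab hy]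
        ring

lemma tendsto_cv_beurlingK {w : ℂ → ℂ} (hw : ContDiff ℝ 1 w) (hc : HasCompactSupport w) (x : ℂ) :
    Tendsto (fun n : ℕ => cv (beurlingK (2 ^ n)⁻¹ ((2 ^ n)⁻¹ * 2 ^ (2 * n))) w x) atTop
      (nhds (-wz (cauchyT w) x)) := by
  have hb : ∀ n : ℕ, ((2 ^ n)⁻¹ * 2 ^ (2 * n) : ℝ) = 2 ^ n := fun n => by
    rw [two_mul, pow_add]; field_simp
  have hab : ∀ n : ℕ, ((2 ^ n)⁻¹ : ℝ) ≤ 2 ^ n := fun n =>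
    (inv_le_one_of_one_le₀ (one_le_pow₀ one_le_two)).trans (one_le_pow₀ one_le_two)
  have hlim : -wz (cauchyT w) x = ∫ y, -(1 / (Real.pi : ℂ)) * (y⁻¹ * wz w (x - y)) * ((1 - 0 : ℝ) : ℂ) := by
    rw [wz_cauchyT hw hc, ← neg_mul, ← integral_const_mul]
    simp
  have hi := (integrable_inv_mul (continuous_wz hw) (hasCompactSupport_wz hc) x).const_mul
    (-(1 / (Real.pi : ℂ)))
  have h2 : Tendsto (fun n : ℕ => (2 : ℝ) ^ n) atTop atTop := tendsto_pow_atTop_atTop_of_one_lt one_lt_two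
  simp_rw [hb, fun n : ℕ => cv_beurlingK_eq (by positivity : (0 : ℝ) < (2 ^ n)⁻¹) (hab n) hw hc x]
  rw [hlim]
  refine tendsto_integral_of_dominated_convergence
    (fun y => ‖-(1 / (Real.pi : ℂ)) * (y⁻¹ * wz w (x - y))‖) (fun n => ?_) hi.norm (fun n => ?_) ?_
  · refine hi.aestronglyMeasurable.mul (Continuous.aestronglyMeasurable ?_)
    fun_prop
  · refine ae_of_all _ fun y => ?_
    rw [norm_mul]
    refine mul_le_of_le_one_right (norm_nonneg _) ?_
    rw [norm_real, Real.norm_eq_abs]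
    have e1 : ∀ s : ℝ, 0 ≤ s → Real.exp (-s * ‖y‖ ^ 2) ≤ 1 := fun s hs => by
      rw [Real.exp_le_one_iff]; nlinarith [mul_nonneg hs (sq_nonneg ‖y‖)]
    have := e1 ((2 ^ n)⁻¹) (by positivity)
    have := e1 ((2 ^ n)⁻¹⁻¹) (by positivity)
    have := Real.exp_pos (-((2 : ℝ) ^ n)⁻¹ * ‖y‖ ^ 2)
    have := Real.exp_pos (-((2 : ℝ) ^ n)⁻¹⁻¹ * ‖y‖ ^ 2)
    rw [abs_le]
    constructor <;> linarith
  · have h0 : ∀ᵐ y : ℂ, y ≠ 0 := by simp [ae_iff]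
    filter_upwards [h0] with y hy
    have hy2 : 0 < ‖y‖ ^ 2 := by positivity
    refine Tendsto.const_mul _ ((continuous_ofReal.tendsto _).comp (Tendsto.sub ?_ ?_))
    · have : Tendsto (fun n : ℕ => -((2 : ℝ) ^ n)⁻¹ * ‖y‖ ^ 2) atTop (nhds (-0 * ‖y‖ ^ 2)) :=
        ((tendsto_inv_atTop_zero.comp h2).neg).mul_const _
      rw [neg_zero, zero_mul] at this
      simpa [Function.comp_def] using (Real.continuous_exp.tendsto 0).comp this
    · refine Real.tendsto_exp_atBot.comp ?_
      simp_rw [inv_inv, neg_mul]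
      exact tendsto_neg_atTop_atBot.comp (h2.atTop_mul_const hy2)

lemma integral_norm_rpow_le_of_tendsto {μ : Measure ℂ} {p A : ℝ} (hp : 0 < p) {f : ℕ → ℂ → ℂ}
    {g : ℂ → ℂ} (hf : ∀ n, Continuous (f n)) (hi : ∀ n, Integrable (fun x => ‖f n x‖ ^ p) μ)
    (hA : ∀ n, ∫ x, ‖f n x‖ ^ p ∂μ ≤ A) (hfg : ∀ x, Tendsto (fun n => f n x) atTop (nhds (g x))) :
    ∫ x, ‖g x‖ ^ p ∂μ ≤ A := by
  have hA0 : 0 ≤ A := (integral_nonneg fun x => by positivity).trans (hA 0)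
  have hg : Measurable g := measurable_of_tendsto_metrizable (fun n => (hf n).measurable)
    (tendsto_pi_nhds.2 hfg)
  rw [integral_eq_lintegral_of_nonneg_ae (ae_of_all _ fun x => by positivity)
    (by fun_prop : Measurable fun x => ‖g x‖ ^ p).aestronglyMeasurable]
  refine ENNReal.toReal_le_of_le_ofReal hA0 ?_
  have hlim : ∀ x, ENNReal.ofReal (‖g x‖ ^ p) =
      liminf (fun n => ENNReal.ofReal (‖f n x‖ ^ p)) atTop := fun x => by
    refine (Tendsto.liminf_eq ?_).symm
    exact (ENNReal.continuous_ofReal.tendsto _).comp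
      (((hfg x).norm).rpow_const (Or.inr hp.le))
  simp_rw [hlim]
  refine (lintegral_liminf_le fun n => ?_).trans ?_
  · have := (hf n).measurable
    fun_prop
  · refine liminf_le_of_frequently_le' (Frequently.of_forall fun n => ?_)
    rw [← ofReal_integral_eq_lintegral_ofReal (hi n) (ae_of_all _ fun x => by positivity)]
    exact ENNReal.ofReal_le_ofReal (hA n)

theorem statement9 (R : ℝ) (hR : 0 < R) (p : ℝ) (hp1 : 1 < p) :
    ∃ n > 0, ∀ w : ℂ → ℂ, ContDiff ℝ 1 w → Function.support w ⊆ ball (0:ℂ) R →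
      (∀ z : ℂ, DifferentiableAt ℝ (cauchyT w) z) ∧
      lpOn R p (wz (cauchyT w)) ≤ n * lpOn R p w := by
  obtain ⟨C, hC, h⟩ := exists_integral_norm_cv_rpow_le hp1
  refine ⟨C ^ (1 / p), by positivity, fun w hw hs => ?_⟩
  have hp0 : 0 < p := by linarith
  have hc : HasCompactSupport w := HasCompactSupport.of_support_subset_isCompact
    (isCompact_closedBall 0 R) (hs.trans ball_subset_closedBall)
  refine ⟨fun z => ?_, ?_⟩
  · obtain ⟨L, hL, -⟩ := hasFDerivAt_cauchyT hw hc z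
    exact hL.differentiableAt
  have hiw : Integrable w := hw.continuous.integrable_of_hasCompactSupport hc
  obtain ⟨M, hM⟩ := hc.exists_bound_of_continuous hw.continuous
  have hball : ∫ x, ‖w x‖ ^ p = ∫ x in ball (0 : ℂ) R, ‖w x‖ ^ p := by
    refine (setIntegral_eq_integral_of_forall_compl_eq_zero fun x hx => ?_).symm
    have : w x = 0 := by
      by_contra h0
      exact hx (hs h0)
    rw [this, norm_zero, Real.zero_rpow hp0.ne']
  have hcont : ∀ n : ℕ, Continuous (cv (beurlingK (2 ^ n)⁻¹ ((2 ^ n)⁻¹ * 2 ^ (2 * n))) w) := fun n => by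
    have ha : (0 : ℝ) < (2 ^ n)⁻¹ := by positivity
    have hab : ((2 ^ n)⁻¹ : ℝ) ≤ (2 ^ n)⁻¹ * 2 ^ (2 * n) :=
      le_mul_of_one_le_right ha.le (one_le_pow₀ one_le_two)
    exact continuous_cv (continuous_beurlingK ha hab) (norm_beurlingK_le ha hab) hiw
  have hfin : ∫ x in ball (0 : ℂ) R, ‖-wz (cauchyT w) x‖ ^ p ≤ C * ∫ x, ‖w x‖ ^ p := by
    refine integral_norm_rpow_le_of_tendsto hp0 hcont (fun n => ?_)
      (fun n => h w hw.continuous hiw ⟨M, hM⟩ _ (by positivity) (2 * n) R)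
      (tendsto_cv_beurlingK hw hc)
    exact (((hcont n).norm.rpow_const fun _ => Or.inr hp0.le).continuousOn.integrableOn_compact
      (isCompact_closedBall 0 R)).mono_set ball_subset_closedBall
  simp_rw [norm_neg, hball] at hfin
  unfold lpOn
  rw [← Real.mul_rpow hC.le (integral_nonneg fun x => by positivity)]
  exact Real.rpow_le_rpow (integral_nonneg fun x => by positivity) hfin (by positivity)
end
end

section
/- Let u : ℂ → ℂ be continuously differentiable (as a function of two real variables) with compact support, and let z₀, λ ∈ ℂ. Define f(z) = −(1/π)·exp(−λ(z−z₀)² + conj(λ)·conj(z−z₀)²)·∫_ℂ exp(λ(ζ−z₀)² − conj(λ)·conj(ζ−z₀)²)·u(ζ)/(conj(ζ)−conj(z)) dA(ζ). Then f is real-differentiable at every z ∈ ℂ and satisfies ∂f/∂z (z) + 2λ(z−z₀)·f(z) = u(z) for all z ∈ ℂ. -/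
open MeasureTheory Metric Complex Filter

noncomputable section

/-- The oscillatory conjugate-Cauchy operator with integral over all of `ℂ`. -/
def TbarC (z0 lam : ℂ) (u : ℂ → ℂ) (z : ℂ) : ℂ :=
  -(1 / (Real.pi : ℂ)) *
    Complex.exp (-(lam * (z - z0) ^ 2) + (starRingEnd ℂ) lam * ((starRingEnd ℂ) (z - z0)) ^ 2) *
    ∫ ζ : ℂ,
      Complex.exp (lam * (ζ - z0) ^ 2 - (starRingEnd ℂ) lam * ((starRingEnd ℂ) (ζ - z0)) ^ 2) *
        u ζ / ((starRingEnd ℂ) ζ - (starRingEnd ℂ) z)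

/-- The Cauchy kernel `1 / conj t` is locally integrable on the plane. -/
lemma locallyIntegrable_inv_conj :
    LocallyIntegrable (fun t : ℂ => ((starRingEnd ℂ) t)⁻¹) volume := by
  refine locallyIntegrable_of_norm_le_rpow (C := 1) (α := 1) ?_ ?_ ?_ ?_
  · simp [Complex.finrank_real_complex]
  · simp [Complex.finrank_real_complex]
  · refine Eventually.of_forall fun t => ?_
    simp [Real.rpow_neg_one]
  · exact (Complex.continuous_conj.measurable.inv).aestronglyMeasurable

/-- A continuous compactly supported field of linear forms, evaluated along the polar frame, is
integrable in polar coordinates. -/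
lemma integrableOn_clm_polar {L : ℂ → ℂ →L[ℝ] ℂ} (hL : Continuous L) (hL' : HasCompactSupport L)
    (h : ℂ) :
    IntegrableOn (fun p : ℝ × ℝ => L (p.1 * cexp (p.2 * I)) (h * cexp (p.2 * I)))
      (Set.Ioi 0 ×ˢ Set.Ioo (-Real.pi) Real.pi) := by
  obtain ⟨R, -, hR⟩ := hL'.isCompact.isBounded.exists_pos_norm_lt
  have hc : Continuous fun p : ℝ × ℝ => L (p.1 * cexp (p.2 * I)) (h * cexp (p.2 * I)) := by
    fun_prop
  have hK : IntegrableOn (fun p : ℝ × ℝ => L (p.1 * cexp (p.2 * I)) (h * cexp (p.2 * I)))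
      (Set.Icc 0 R ×ˢ Set.Icc (-Real.pi) Real.pi) :=
    hc.continuousOn.integrableOn_compact (isCompact_Icc.prod isCompact_Icc)
  refine hK.of_forall_sdiff_eq_zero (measurableSet_Ioi.prod measurableSet_Ioo) ?_
  rintro ⟨r, θ⟩ ⟨⟨hr, hθ⟩, hn⟩
  have hr0 : 0 < r := hr
  have hrR : R < r := by
    by_contra! hle
    exact hn ⟨⟨hr0.le, hle⟩, ⟨hθ.1.le, hθ.2.le⟩⟩
  have : L (r * cexp (θ * I)) = 0 := by
    refine image_eq_zero_of_notMem_tsupport fun hmem => ?_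
    have h1 := hR _ hmem
    rw [norm_mul, Complex.norm_exp_ofReal_mul_I, mul_one, Complex.norm_real, Real.norm_eq_abs,
      abs_of_pos hr0] at h1
    exact absurd h1 hrR.not_gt
  simp [this]

lemma integral_radial_deriv {g : ℂ → ℂ} (hg : ContDiff ℝ 1 g) (hg' : HasCompactSupport g)
    (θ : ℝ) :
    ∫ r in Set.Ioi (0 : ℝ), fderiv ℝ g (r * cexp (θ * I)) (cexp (θ * I)) = -g 0 := by
  have hd (r : ℝ) : HasDerivAt (fun r : ℝ => g (r * cexp (θ * I)))
      (fderiv ℝ g (r * cexp (θ * I)) (cexp (θ * I))) r := by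
    have h1 : HasDerivAt (fun r : ℝ => (r : ℂ) * cexp (θ * I)) (cexp (θ * I)) r := by
      simpa using (Complex.ofRealCLM.hasDerivAt (x := r)).mul_const (cexp (θ * I))
    exact ((hg.differentiable one_ne_zero _).hasFDerivAt).comp_hasDerivAt r h1
  have hC : ContDiff ℝ 1 fun r : ℝ => g (r * cexp (θ * I)) :=
    hg.comp (Complex.ofRealCLM.contDiff.mul contDiff_const)
  have hemb : Topology.IsClosedEmbedding fun r : ℝ => (r : ℂ) * cexp (θ * I) :=
    (Homeomorph.mulRight₀ _ (Complex.exp_ne_zero (θ * I))).isClosedEmbedding.comp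
      Complex.isometry_ofReal.isClosedEmbedding
  have := HasCompactSupport.integral_Ioi_deriv_eq hC (hg'.comp_isClosedEmbedding hemb) 0
  simpa [fun r => (hd r).deriv] using this

lemma integral_angular_deriv {g : ℂ → ℂ} (hg : ContDiff ℝ 1 g) {r : ℝ} (hr : r ≠ 0) :
    ∫ θ in Set.Ioo (-Real.pi) Real.pi,
      fderiv ℝ g (r * cexp (θ * I)) (I * cexp (θ * I)) = 0 := by
  have hd (θ : ℝ) : HasDerivAt (fun θ : ℝ => g (r * cexp (θ * I)))
      (r * fderiv ℝ g (r * cexp (θ * I)) (I * cexp (θ * I))) θ := by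
    have h1 : HasDerivAt (fun θ : ℝ => (r : ℂ) * cexp (θ * I))
        (r • (I * cexp (θ * I))) θ := by
      have h2 := (((Complex.ofRealCLM.hasDerivAt (x := θ)).mul_const I).cexp).const_mul (r : ℂ)
      convert! h2 using 1
      simp [mul_comm]
    have h3 := ((hg.differentiable one_ne_zero _).hasFDerivAt).comp_hasDerivAt θ h1
    convert! h3 using 1
    rw [map_smul, Complex.real_smul]
  have hcont : Continuous fun θ : ℝ =>
      (r : ℂ) * fderiv ℝ g (r * cexp (θ * I)) (I * cexp (θ * I)) := by
    have := hg.continuous_fderiv one_ne_zero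
    fun_prop
  have h := intervalIntegral.integral_eq_sub_of_hasDerivAt (fun θ _ => hd θ)
    (hcont.intervalIntegrable (-Real.pi) Real.pi)
  rw [intervalIntegral.integral_const_mul,
    intervalIntegral.integral_of_le (by linarith [Real.pi_pos]),
    integral_Ioc_eq_integral_Ioo] at h
  have h0 : cexp ((-Real.pi : ℝ) * I) = cexp (Real.pi * I) := by
    rw [Complex.exp_pi_mul_I]; simp [Complex.exp_neg]
  rw [h0, sub_self] at h
  exact (mul_eq_zero.mp h).resolve_left (by exact_mod_cast hr)

lemma clm_apply_eq_re_im (L : ℂ →L[ℝ] ℂ) (w : ℂ) : L w = w.re * L 1 + w.im * L I := by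
  conv_lhs => rw [← Complex.re_add_im w]
  have h1 : (w.re : ℂ) + w.im * I = w.re • (1 : ℂ) + w.im • I := by simp
  rw [h1, map_add, map_smul, map_smul, Complex.real_smul, Complex.real_smul]

/-- The distributional identity `∂/∂z (1 / (π conj z)) = δ`. -/
lemma integral_inv_conj_mul_wz {g : ℂ → ℂ} (hg : ContDiff ℝ 1 g) (hg' : HasCompactSupport g) :
    ∫ t : ℂ, ((starRingEnd ℂ) t)⁻¹ * wz g t = -(Real.pi * g 0) := by
  have hL := hg.continuous_fderiv one_ne_zero
  have hL' := hg'.fderiv ℝ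
  have hA := integrableOn_clm_polar hL hL' 1
  have hB := integrableOn_clm_polar hL hL' I
  have hpt : ∀ p ∈ polarCoord.target,
      p.1 • (((starRingEnd ℂ) (Complex.polarCoord.symm p))⁻¹ * wz g (Complex.polarCoord.symm p)) =
      (1 / 2 : ℂ) * fderiv ℝ g (p.1 * cexp (p.2 * I)) (1 * cexp (p.2 * I)) +
      (-(I / 2)) * fderiv ℝ g (p.1 * cexp (p.2 * I)) (I * cexp (p.2 * I)) := by
    rintro ⟨r, θ⟩ ⟨hr, -⟩
    have hr0 : (r : ℂ) ≠ 0 := by exact_mod_cast (show (0 : ℝ) < r from hr).ne'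
    have hs : Complex.polarCoord.symm (r, θ) = r * cexp (θ * I) := by
      simp [Complex.exp_mul_I]
    have hconj : ((starRingEnd ℂ) (r * cexp (θ * I)))⁻¹ = (r : ℂ)⁻¹ * cexp (θ * I) := by
      rw [map_mul, ← Complex.exp_conj, mul_inv, ← Complex.exp_neg]
      simp
    have he : cexp (θ * I) = Real.cos θ + Real.sin θ * I := by
      simp [Complex.exp_mul_I]
    have hre : (cexp (θ * I)).re = Real.cos θ := Complex.exp_ofReal_mul_I_re θ
    have him : (cexp (θ * I)).im = Real.sin θ := Complex.exp_ofReal_mul_I_im θ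
    have hre' : (I * cexp (θ * I)).re = -Real.sin θ := by simp [him]
    have him' : (I * cexp (θ * I)).im = Real.cos θ := by simp [hre]
    rw [hs, hconj, Complex.real_smul, wz]
    simp only
    rw [one_mul, clm_apply_eq_re_im _ (cexp (θ * I)), clm_apply_eq_re_im _ (I * cexp (θ * I)),
      hre, him, hre', him', mul_assoc, mul_inv_cancel_left₀ hr0, Complex.ofReal_neg]
    generalize fderiv ℝ g (r * cexp (θ * I)) = L
    rw [he]
    linear_combination (-(1 / 2 : ℂ) * Real.sin θ * L I) * Complex.I_sq
  rw [← Complex.integral_comp_polarCoord_symm,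
    setIntegral_congr_fun polarCoord.open_target.measurableSet hpt, polarCoord_target,
    integral_add (hA.const_mul _) (hB.const_mul _), integral_const_mul, integral_const_mul,
    Measure.volume_eq_prod, setIntegral_prod _ hB]
  have hBz : ∫ r in Set.Ioi (0 : ℝ), ∫ θ in Set.Ioo (-Real.pi) Real.pi,
      fderiv ℝ g (r * cexp (θ * I)) (I * cexp (θ * I)) = 0 :=
    setIntegral_eq_zero_of_forall_eq_zero fun r hr =>
      integral_angular_deriv hg (show (0 : ℝ) < r from hr).ne'
  have hAz : ∫ p in Set.Ioi (0 : ℝ) ×ˢ Set.Ioo (-Real.pi) Real.pi,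
      fderiv ℝ g (p.1 * cexp (p.2 * I)) (1 * cexp (p.2 * I)) ∂(volume.prod volume) =
      -(2 * Real.pi * g 0) := by
    rw [← Measure.prod_restrict, integral_prod_symm _ (by
      rw [Measure.prod_restrict]; exact hA)]
    simp only [one_mul, integral_radial_deriv hg hg', setIntegral_const,
      Complex.real_smul, Real.volume_real_Ioo_of_le (by linarith [Real.pi_pos] :
        -Real.pi ≤ Real.pi)]
    push_cast
    ring
  rw [hBz, hAz]
  ring

/-- The conjugate Cauchy transform of `v`, up to the factor `1 / π`. -/
def conjCauchy (v : ℂ → ℂ) : ℂ → ℂ :=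
  convolution (fun t : ℂ => ((starRingEnd ℂ) t)⁻¹) v (ContinuousLinearMap.mul ℝ ℂ) volume

lemma hasFDerivAt_conjCauchy {v : ℂ → ℂ} (hv : ContDiff ℝ 1 v) (hv' : HasCompactSupport v)
    (z : ℂ) :
    HasFDerivAt (conjCauchy v)
      (convolution (fun t : ℂ => ((starRingEnd ℂ) t)⁻¹) (fderiv ℝ v)
        ((ContinuousLinearMap.mul ℝ ℂ).precompR ℂ) volume z) z :=
  hv'.hasFDerivAt_convolution_right _ locallyIntegrable_inv_conj hv z

lemma wz_conjCauchy {v : ℂ → ℂ} (hv : ContDiff ℝ 1 v) (hv' : HasCompactSupport v) (z : ℂ) :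
    wz (conjCauchy v) z = Real.pi * v z := by
  have hL := hv.continuous_fderiv one_ne_zero
  have hL' := hv'.fderiv ℝ
  have h_int (w : ℂ) : Integrable fun t : ℂ =>
      ((starRingEnd ℂ) t)⁻¹ * fderiv ℝ v (z - t) w :=
    (hL'.comp_left (g := fun L : ℂ →L[ℝ] ℂ => L w) (by simp)).convolutionExists_right
      (ContinuousLinearMap.mul ℝ ℂ) locallyIntegrable_inv_conj (by fun_prop) z
  have hg : ContDiff ℝ 1 fun t => v (z - t) := hv.comp (contDiff_const.sub contDiff_id)
  have hg' : HasCompactSupport fun t => v (z - t) :=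
    hv'.comp_homeomorph (Homeomorph.subLeft z)
  have hfd (t : ℂ) : fderiv ℝ (fun t => v (z - t)) t = -fderiv ℝ v (z - t) := by
    have h1 : HasFDerivAt (fun t : ℂ => z - t) (-ContinuousLinearMap.id ℝ ℂ) t :=
      (hasFDerivAt_id t).const_sub z
    have h2 := ((hv.differentiable one_ne_zero (z - t)).hasFDerivAt.comp t h1).fderiv
    refine Eq.trans h2 ?_
    ext; simp
  have hmain := integral_inv_conj_mul_wz hg hg'
  rw [wz, (hasFDerivAt_conjCauchy hv hv' z).fderiv,
    convolution_precompR_apply _ locallyIntegrable_inv_conj hL' hL,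
    convolution_precompR_apply _ locallyIntegrable_inv_conj hL' hL]
  simp only [convolution_def, ContinuousLinearMap.mul_apply']
  rw [← integral_const_mul, ← integral_sub (h_int 1) ((h_int I).const_mul I),
    ← integral_const_mul]
  rw [sub_zero] at hmain
  rw [← neg_eq_iff_eq_neg.mpr hmain, ← integral_neg]
  congr 1
  ext t
  rw [wz, hfd]
  simp only [neg_apply]
  ring

lemma conjCauchy_apply (v : ℂ → ℂ) (z : ℂ) :
    conjCauchy v z = -∫ ζ : ℂ, v ζ / ((starRingEnd ℂ) ζ - (starRingEnd ℂ) z) := by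
  rw [conjCauchy, convolution_eq_swap, ← integral_neg]
  congr 1
  ext ζ
  rw [ContinuousLinearMap.mul_apply', map_sub, ← neg_sub, inv_neg, div_eq_mul_inv]
  ring

lemma hasFDerivAt_oscillation (z0 lam z : ℂ) :
    HasFDerivAt (fun z : ℂ =>
      cexp (-(lam * (z - z0) ^ 2) + (starRingEnd ℂ) lam * ((starRingEnd ℂ) (z - z0)) ^ 2))
      (cexp (-(lam * (z - z0) ^ 2) + (starRingEnd ℂ) lam * ((starRingEnd ℂ) (z - z0)) ^ 2) •
        ((-(2 * lam * (z - z0))) • (1 : ℂ →L[ℝ] ℂ) +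
          (2 * (starRingEnd ℂ) lam * (starRingEnd ℂ) (z - z0)) • (conjCLE : ℂ →L[ℝ] ℂ))) z := by
  have h1 : HasFDerivAt (fun z : ℂ => z - z0) (1 : ℂ →L[ℝ] ℂ) z :=
    (hasFDerivAt_id z).sub_const z0
  have h2 : HasFDerivAt (fun z : ℂ => (starRingEnd ℂ) (z - z0)) (conjCLE : ℂ →L[ℝ] ℂ) z :=
    (conjCLE : ℂ →L[ℝ] ℂ).hasFDerivAt.comp z h1
  refine HasFDerivAt.cexp ?_
  convert! ((h1.pow 2).const_mul lam).neg.add ((h2.pow 2).const_mul ((starRingEnd ℂ) lam)) using 1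
  ext; simp; ring

theorem statement10 (u : ℂ → ℂ) (hu : ContDiff ℝ 1 u) (hsupp : HasCompactSupport u)
    (z0 lam : ℂ) (z : ℂ) :
    DifferentiableAt ℝ (TbarC z0 lam u) z ∧
      wz (TbarC z0 lam u) z + 2 * lam * (z - z0) * TbarC z0 lam u z = u z := by
  set v : ℂ → ℂ := fun ζ => phase lam z0 ζ * u ζ with hv_def
  have hphase : ContDiff ℝ 1 (phase lam z0) := by
    have hc : ContDiff ℝ 1 fun ζ : ℂ => (starRingEnd ℂ) (ζ - z0) :=
      conjCLE.contDiff.comp (contDiff_id.sub contDiff_const)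
    unfold phase
    fun_prop
  have hv : ContDiff ℝ 1 v := hphase.mul hu
  have hv' : HasCompactSupport v := hsupp.mul_left
  set E : ℂ → ℂ := fun z =>
    cexp (-(lam * (z - z0) ^ 2) + (starRingEnd ℂ) lam * ((starRingEnd ℂ) (z - z0)) ^ 2) with hE_def
  have hT : TbarC z0 lam u = fun z => (Real.pi : ℂ)⁻¹ * (E z * conjCauchy v z) := by
    ext w
    rw [conjCauchy_apply, TbarC]
    simp only [hv_def, hE_def, phase]
    ring
  have hG := hasFDerivAt_conjCauchy hv hv' z
  have hGw := wz_conjCauchy hv hv' z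
  rw [wz, hG.fderiv] at hGw
  have hF := ((hasFDerivAt_oscillation z0 lam z).mul hG).const_mul (Real.pi : ℂ)⁻¹
  rw [hT]
  refine ⟨hF.differentiableAt, ?_⟩
  have hEv : E z * v z = u z := by
    simp only [hE_def, hv_def, phase, ← mul_assoc, ← Complex.exp_add]
    rw [show -(lam * (z - z0) ^ 2) + (starRingEnd ℂ) lam * ((starRingEnd ℂ) (z - z0)) ^ 2 +
      (lam * (z - z0) ^ 2 - (starRingEnd ℂ) lam * ((starRingEnd ℂ) (z - z0)) ^ 2) = 0 by ring]
    simp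
  have hpi : (Real.pi : ℂ)⁻¹ * Real.pi = 1 :=
    inv_mul_cancel₀ (by exact_mod_cast Real.pi_ne_zero)
  have hfd : fderiv ℝ (fun z => (Real.pi : ℂ)⁻¹ * (E z * conjCauchy v z)) z = _ := hF.fderiv
  rw [wz, hfd]
  change _ + 2 * lam * (z - z0) * ((Real.pi : ℂ)⁻¹ * (E z * conjCauchy v z)) = _
  rw [show cexp (-(lam * (z - z0) ^ 2) +
    (starRingEnd ℂ) lam * ((starRingEnd ℂ) (z - z0)) ^ 2) = E z from rfl]
  simp only [add_apply, smul_apply, smul_eq_mul,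
    one_apply_eq_self, ContinuousLinearEquiv.coe_coe, conjCLE_apply, map_one, conj_I]
  linear_combination (E z * (Real.pi : ℂ)⁻¹) * hGw + hEv + (E z * v z) * hpi +
    (-(1 / 2) * (Real.pi : ℂ)⁻¹ * conjCauchy v z * E z *
      (-(2 * lam * (z - z0)) - 2 * (starRingEnd ℂ) lam * (starRingEnd ℂ) (z - z0))) * Complex.I_sq
end
end

section
/- Let D = B(0,R) ⊂ ℂ be the open disc of radius R > 0, let z₀, λ ∈ ℂ, ζ ∈ D, and define G_{z₀}(z,ζ,λ) = exp(λ(z−z₀)²)·g_{z₀}(z,ζ,λ)·exp(−λ(ζ−z₀)²). Then for every smooth function φ : ℂ → ℂ with compact support contained in D, ∫_D G_{z₀}(z,ζ,λ)·Δφ(z) dA(z) = φ(ζ), where Δφ = ∂²φ/∂x₁² + ∂²φ/∂x₂². In other words, z ↦ G_{z₀}(z,ζ,λ) is a Green's function for the Laplacian: 4·∂²G_{z₀}/∂z∂z̄ = δ(z−ζ) in the distributional sense. -/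
open MeasureTheory Metric Complex Filter

noncomputable section

/-- The Laplacian `Δφ = ∂²φ/∂x₁² + ∂²φ/∂x₂²` of `φ : ℂ → ℂ`. -/
def lap (φ : ℂ → ℂ) (z : ℂ) : ℂ :=
  fderiv ℝ (fun w => fderiv ℝ φ w 1) z 1 + fderiv ℝ (fun w => fderiv ℝ φ w Complex.I) z Complex.I

/-- `G_{z₀}(z,ζ,λ) = exp(λ(z−z₀)²)·g_{z₀}(z,ζ,λ)·exp(−λ(ζ−z₀)²)`. -/
def Gker (R : ℝ) (z0 lam z ζ : ℂ) : ℂ :=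
  Complex.exp (lam * (z - z0) ^ 2) * gker R z0 lam z ζ * Complex.exp (-(lam * (ζ - z0) ^ 2))

theorem fderiv_polar_identity (L : ℂ →L[ℝ] ℂ) (θ : ℝ) :
    L 1 + I * L I = (Real.cos θ + Real.sin θ * I) *
      (L (Real.cos θ + Real.sin θ * I) + I * L (I * (Real.cos θ + Real.sin θ * I))) := by
  have h (a b : ℝ) : L (a + b * I) = a * L 1 + b * L I := by
    have : (a + b * I : ℂ) = a • (1 : ℂ) + b • I := by simp
    rw [this, map_add, map_smul, map_smul]
    simp
  have h2 : I * (Real.cos θ + Real.sin θ * I) = ((-Real.sin θ : ℝ) + Real.cos θ * I : ℂ) := by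
    push_cast
    linear_combination (Complex.sin θ : ℂ) * I_sq
  have h3 : (Real.cos θ : ℂ) ^ 2 + (Real.sin θ : ℂ) ^ 2 = 1 := by
    exact_mod_cast Real.cos_sq_add_sin_sq θ
  rw [h2, h, h]
  push_cast at *
  linear_combination (-L 1 - I * L I) * h3 +
    (Complex.sin θ ^ 2 * L 1 - L I * Complex.cos θ * Complex.sin θ) * I_sq

/-- The Cauchy–Pompeiu formula for compactly supported functions: `1 / (π (z - a))` is a fundamental
solution of `∂/∂z̄`. -/
theorem cauchy_pompeiu {ψ : ℂ → ℂ} (hψ : ContDiff ℝ 1 ψ) (hc : HasCompactSupport ψ) (a : ℂ) :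
    ∫ z, wbar ψ z / (z - a) = -Real.pi * ψ a := by
  let e : ℝ → ℂ := fun θ => Real.cos θ + Real.sin θ * I
  have he : Continuous e := by fun_prop
  have hnorm (θ : ℝ) : ‖e θ‖ = 1 := by
    simp only [e, ofReal_cos, ofReal_sin]
    exact norm_cos_add_sin_mul_I θ
  have hed (θ : ℝ) : HasDerivAt e (I * e θ) θ := by
    have h1 := (Real.hasDerivAt_cos θ).ofReal_comp
    have h2 := ((Real.hasDerivAt_sin θ).ofReal_comp).mul_const I
    refine (h1.add h2).congr_deriv ?_
    simp only [e]
    push_cast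
    linear_combination -(Complex.sin θ : ℂ) * I_sq
  have hdiff : Differentiable ℝ ψ := hψ.differentiable one_ne_zero
  let F : ℝ × ℝ → ℂ := fun p => fderiv ℝ ψ (p.1 * e p.2 + a) (e p.2)
  let G : ℝ × ℝ → ℂ := fun p => fderiv ℝ ψ (p.1 * e p.2 + a) (I * e p.2)
  have hfd : Continuous (fderiv ℝ ψ) := hψ.continuous_fderiv one_ne_zero
  have hF : Continuous F := by
    refine (hfd.comp ?_).clm_apply ?_ <;> fun_prop
  have hG : Continuous G := by
    refine (hfd.comp ?_).clm_apply ?_ <;> fun_prop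
  obtain ⟨M, hM⟩ : ∃ M : ℝ, ∀ r θ : ℝ, M < r →
      ψ (r * e θ + a) = 0 ∧ fderiv ℝ ψ (r * e θ + a) = 0 := by
    obtain ⟨C, hC⟩ := hc.isCompact.isBounded.exists_norm_le
    refine ⟨C + ‖a‖, fun r θ hr => ?_⟩
    have hnot : r * e θ + a ∉ tsupport ψ := fun hmem => by
      have h1 := hC _ hmem
      have h2 : ‖r * e θ‖ = |r| := by rw [norm_mul, hnorm, mul_one, norm_real, Real.norm_eq_abs]
      have h3 := norm_sub_le (r * e θ + a) a
      rw [add_sub_cancel_right, h2] at h3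
      linarith [le_abs_self r]
    exact ⟨image_eq_zero_of_notMem_tsupport hnot,
      Function.notMem_support.1 fun h => hnot (support_fderiv_subset ℝ h)⟩
  have hint {H : ℝ × ℝ → ℂ} (hH : Continuous H) (h0 : ∀ r θ, M < r → H (r, θ) = 0) :
      IntegrableOn H (Set.Ioi (0 : ℝ) ×ˢ Set.Ioo (-Real.pi) Real.pi) := by
    have h1 : IntegrableOn H (Set.Icc (0 : ℝ) M ×ˢ Set.Icc (-Real.pi) Real.pi) :=
      hH.continuousOn.integrableOn_compact (isCompact_Icc.prod isCompact_Icc)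
    refine h1.of_forall_sdiff_eq_zero (measurableSet_Ioi.prod measurableSet_Ioo) ?_
    rintro ⟨r, θ⟩ ⟨⟨hr, hθ⟩, h⟩
    refine h0 r θ ?_
    by_contra! hle
    exact h ⟨⟨le_of_lt hr, hle⟩, Set.Ioo_subset_Icc_self hθ⟩
  have hFi := hint hF fun r θ h => by simp [F, (hM r θ h).2]
  have hGi := hint hG fun r θ h => by simp [G, (hM r θ h).2]
  have hFint : ∫ p in Set.Ioi (0 : ℝ) ×ˢ Set.Ioo (-Real.pi) Real.pi, F p
      = -(2 * Real.pi) * ψ a := by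
    rw [Measure.volume_eq_prod, ← setIntegral_prod_swap, setIntegral_prod (fun z => F z.swap) ?_]
    swap
    · have := hFi
      rw [IntegrableOn, Measure.volume_eq_prod, ← Measure.prod_restrict] at this
      rw [IntegrableOn, ← Measure.prod_restrict]
      exact this.swap
    have (θ : ℝ) : ∫ r in Set.Ioi (0 : ℝ), F (r, θ) = - ψ a := by
      have hd (r : ℝ) : HasDerivAt (fun r : ℝ => ψ (r * e θ + a)) (F (r, θ)) r := by
        have := (hdiff (r * e θ + a)).hasFDerivAt.comp_hasDerivAt r
          ((((hasDerivAt_id r).ofReal_comp).mul_const (e θ)).add_const a)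
        exact this.congr_deriv (by simp [F])
      have hi : IntegrableOn (fun r => F (r, θ)) (Set.Ioi 0) := by
        have h1 : IntegrableOn (fun r => F (r, θ)) (Set.Icc (0 : ℝ) M) :=
          (hF.comp (by fun_prop)).continuousOn.integrableOn_compact isCompact_Icc
        refine h1.of_forall_sdiff_eq_zero measurableSet_Ioi ?_
        rintro r ⟨hr, h⟩
        have hMr : M < r := by
          by_contra! hle
          exact h ⟨le_of_lt hr, hle⟩
        simp [F, (hM r θ hMr).2]
      have ht : Tendsto (fun r : ℝ => ψ (r * e θ + a)) atTop (nhds 0) :=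
        tendsto_const_nhds.congr' <| (eventually_gt_atTop M).mono fun r hr => (hM r θ hr).1.symm
      rw [integral_Ioi_of_hasDerivAt_of_tendsto (hd 0).continuousAt.continuousWithinAt
        (fun r _ => hd r) hi ht]
      simp
    simp only [Prod.swap_prod_mk, this]
    rw [setIntegral_const, Measure.real, Real.volume_Ioo,
      ENNReal.toReal_ofReal (by linarith [Real.pi_pos]), real_smul]
    push_cast
    ring
  have hGint : ∫ p in Set.Ioi (0 : ℝ) ×ˢ Set.Ioo (-Real.pi) Real.pi, G p = 0 := by
    rw [Measure.volume_eq_prod, setIntegral_prod _ hGi]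
    refine setIntegral_eq_zero_of_forall_eq_zero fun r hr => ?_
    rw [← integral_Ioc_eq_integral_Ioo,
      ← intervalIntegral.integral_of_le (by linarith [Real.pi_pos])]
    have hr0 : (r : ℂ) ≠ 0 := by exact_mod_cast ne_of_gt hr
    have hd (θ : ℝ) : HasDerivAt (fun θ => (r : ℂ)⁻¹ * ψ (r * e θ + a)) (G (r, θ)) θ := by
      have := (hdiff (r * e θ + a)).hasFDerivAt.comp_hasDerivAt θ
        (((hed θ).const_mul (r : ℂ)).add_const a)
      refine (this.const_mul (r : ℂ)⁻¹).congr_deriv ?_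
      rw [show (r : ℂ) * (I * e θ) = r • (I * e θ) from rfl, map_smul, Complex.real_smul,
        inv_mul_cancel_left₀ hr0]
    rw [intervalIntegral.integral_eq_sub_of_hasDerivAt (fun θ _ => hd θ)
      (by apply Continuous.intervalIntegrable; fun_prop)]
    simp [e]
  calc ∫ z, wbar ψ z / (z - a) = ∫ w, wbar ψ (w + a) / w := by
        rw [← integral_add_right_eq_self _ a]
        simp
    _ = ∫ p in Set.Ioi (0 : ℝ) ×ˢ Set.Ioo (-Real.pi) Real.pi, (1 / 2 : ℂ) * (F p + I * G p) := by
        rw [← Complex.integral_comp_polarCoord_symm]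
        refine setIntegral_congr_fun (measurableSet_Ioi.prod measurableSet_Ioo) ?_
        rintro ⟨r, θ⟩ ⟨hr, -⟩
        have hr0 : (r : ℂ) ≠ 0 := by exact_mod_cast ne_of_gt hr
        have he0 : e θ ≠ 0 := norm_ne_zero_iff.1 (by simp [hnorm])
        simp only [Complex.polarCoord_symm_apply, wbar, F, G]
        rw [fderiv_polar_identity _ θ, Complex.real_smul]
        change (r : ℂ) * (1 / 2 * (e θ * _) / (r * e θ)) = _
        rw [mul_comm I (e θ)]
        field_simp
        rw [mul_comm (e θ) I]
    _ = _ := by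
        rw [integral_const_mul, integral_add hFi (hGi.const_mul I), integral_const_mul,
          hFint, hGint]
        ring

theorem integrable_indicator_ball_inv (r : ℝ) :
    Integrable ((ball (0 : ℂ) r).indicator fun w => w⁻¹) := by
  rw [integrable_indicator_iff measurableSet_ball]
  refine integrableOn_ball_of_norm_le_rpow (C := 1) (α := 1) ?_ ?_ ?_ ?_
  · simp
  · simp
  · refine Eventually.of_forall fun w => ?_
    rw [norm_inv, Real.rpow_neg_one, one_mul]
  · exact measurable_inv.aestronglyMeasurable

theorem wbar_mul_of_differentiableAt {h ψ : ℂ → ℂ} {z : ℂ} (hh : DifferentiableAt ℂ h z)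
    (hψ : DifferentiableAt ℝ ψ z) : wbar (fun w => h w * ψ w) z = h z * wbar ψ z := by
  have h1 : fderiv ℝ (fun w => h w * ψ w) z =
      h z • fderiv ℝ ψ z + ψ z • (fderiv ℂ h z).restrictScalars ℝ :=
    ((hh.hasFDerivAt.restrictScalars ℝ).mul hψ.hasFDerivAt).fderiv
  have h2 : fderiv ℂ h z I = I * fderiv ℂ h z 1 := by
    rw [← smul_eq_mul, ← map_smul, smul_eq_mul, mul_one]
  simp only [wbar, h1, add_apply, smul_apply,
    ContinuousLinearMap.coe_restrictScalars', h2, smul_eq_mul]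
  linear_combination (1 / 2 * ψ z * fderiv ℂ h z 1) * I_sq

theorem wbar_conj {ψ : ℂ → ℂ} {z : ℂ} (hψ : DifferentiableAt ℝ ψ z) :
    wbar (fun w => (starRingEnd ℂ) (ψ w)) z = (starRingEnd ℂ) (wz ψ z) := by
  have h1 : fderiv ℝ (fun w => (starRingEnd ℂ) (ψ w)) z =
      (conjCLE : ℂ →L[ℝ] ℂ).comp (fderiv ℝ ψ z) :=
    ((conjCLE : ℂ →L[ℝ] ℂ).hasFDerivAt.comp z hψ.hasFDerivAt).fderiv
  simp only [wbar, wz, h1, ContinuousLinearMap.comp_apply, map_mul, map_sub, map_div₀, map_one,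
    map_ofNat, conj_I]
  change 1 / 2 * ((starRingEnd ℂ) _ + I * (starRingEnd ℂ) _) = _
  ring

theorem wz_conj_mul_of_differentiableAt {h ψ : ℂ → ℂ} {z : ℂ} (hh : DifferentiableAt ℂ h z)
    (hψ : DifferentiableAt ℝ ψ z) :
    wz (fun w => (starRingEnd ℂ) (h w) * ψ w) z = (starRingEnd ℂ) (h z) * wz ψ z := by
  have hc {u : ℂ → ℂ} (hu : DifferentiableAt ℝ u z) :
      DifferentiableAt ℝ (fun w => (starRingEnd ℂ) (u w)) z :=
    (conjCLE : ℂ →L[ℝ] ℂ).differentiableAt.comp z hu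
  apply (starRingEnd ℂ).injective
  rw [← wbar_conj (ψ := fun w => (starRingEnd ℂ) (h w) * ψ w)
    ((hc (hh.restrictScalars ℝ)).mul hψ)]
  simp only [map_mul, conj_conj]
  rw [wbar_mul_of_differentiableAt hh (hc hψ), wbar_conj hψ]

theorem cauchy_pompeiu_conj {ψ : ℂ → ℂ} (hψ : ContDiff ℝ 1 ψ) (hc : HasCompactSupport ψ) (a : ℂ) :
    ∫ z, wz ψ z / ((starRingEnd ℂ) z - (starRingEnd ℂ) a) = -Real.pi * ψ a := by
  have h := cauchy_pompeiu ((conjCLE : ℂ →L[ℝ] ℂ).contDiff.comp hψ)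
    (hc.comp_left (g := (conjCLE : ℂ →L[ℝ] ℂ)) (map_zero _)) a
  apply (starRingEnd ℂ).injective
  rw [← integral_conj]
  simp only [map_div₀, map_sub, conj_conj, map_mul, map_neg, conj_ofReal]
  rw [← show _ = -Real.pi * (starRingEnd ℂ) (ψ a) from h]
  refine integral_congr_ae (Eventually.of_forall fun z => ?_)
  simp only
  rw [← wbar_conj (hψ.differentiable one_ne_zero z)]
  rfl

theorem lap_eq_four_mul_wbar_wz {φ : ℂ → ℂ} (hφ : ContDiff ℝ 2 φ) (z : ℂ) :
    lap φ z = 4 * wbar (wz φ) z := by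
  have hd : Differentiable ℝ (fderiv ℝ φ) :=
    (hφ.fderiv_right (m := 1) le_rfl).differentiable one_ne_zero
  have hv (v : ℂ) : HasFDerivAt (fun w => fderiv ℝ φ w v)
      ((fderiv ℝ (fderiv ℝ φ) z).flip v) z := by
    simpa using (hd z).hasFDerivAt.clm_apply (hasFDerivAt_const v z)
  have hsymm : fderiv ℝ (fderiv ℝ φ) z 1 I = fderiv ℝ (fderiv ℝ φ) z I 1 :=
    hφ.contDiffAt.isSymmSndFDerivAt (by simp) 1 I
  have hwz : fderiv ℝ (wz φ) z = _ :=
    (((hv 1).sub ((hv I).const_mul I)).const_mul (1 / 2 : ℂ)).fderiv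
  simp only [lap, wbar, hwz, (hv _).fderiv]
  simp only [smul_apply, sub_apply,
    ContinuousLinearMap.flip_apply, smul_eq_mul, hsymm]
  linear_combination (fderiv ℝ (fderiv ℝ φ) z I I) * I_sq

theorem contDiff_wz {φ : ℂ → ℂ} {n m : ℕ∞} (hφ : ContDiff ℝ n φ) (h : m + 1 ≤ n) :
    ContDiff ℝ m (wz φ) := by
  have := hφ.fderiv_right (m := m) (by exact_mod_cast h)
  unfold wz
  fun_prop

theorem support_wz_subset (φ : ℂ → ℂ) : Function.support (wz φ) ⊆ tsupport φ := by
  intro z hz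
  refine support_fderiv_subset ℝ (f := φ) fun h => hz ?_
  simp [wz, h]

theorem integrable_mul_double_cauchy_kernel (R : ℝ) {ζ : ℂ} (hζ : ζ ∈ ball (0 : ℂ) R) {E k : ℂ → ℂ}
    (hE : Continuous E) (hk : Continuous k) (hkc : HasCompactSupport k)
    (hkR : Function.support k ⊆ ball (0 : ℂ) R) :
    Integrable (fun p : ℂ × ℂ =>
        k p.1 * (E p.2 / ((p.1 - p.2) * ((starRingEnd ℂ) p.2 - (starRingEnd ℂ) ζ))))
      (volume.prod (volume.restrict (ball (0 : ℂ) R))) := by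
  have hinv := integrable_indicator_ball_inv (2 * R)
  have hfar {z w : ℂ} (hz : z ∈ ball (0 : ℂ) R) (hw : w ∈ ball (0 : ℂ) R) :
      z - w ∈ ball (0 : ℂ) (2 * R) := by
    rw [mem_ball_zero_iff] at *
    linarith [norm_sub_le z w]
  obtain ⟨C, hC⟩ := (isCompact_closedBall (0 : ℂ) R).exists_bound_of_continuousOn hE.continuousOn
  have hf : Integrable (fun η => E η * (starRingEnd ℂ)
      ((ball (0 : ℂ) (2 * R)).indicator (fun w => w⁻¹) (η - ζ)))
      (volume.restrict (ball (0 : ℂ) R)) := by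
    refine Integrable.bdd_mul (c := C) ?_ hE.aestronglyMeasurable ?_
    · exact ((conjCLE : ℂ →L[ℝ] ℂ).integrable_comp (hinv.comp_sub_right ζ)).restrict
    · exact (ae_restrict_mem measurableSet_ball).mono fun η h => hC η (ball_subset_closedBall h)
  obtain ⟨K, hK⟩ := hkc.exists_bound_of_continuous hk
  have hconv := (hf.convolution_integrand (ContinuousLinearMap.mul ℝ ℂ) hinv).bdd_mul (c := K)
    (f := fun p : ℂ × ℂ => k p.1) (hk.comp continuous_fst).aestronglyMeasurable
    (Eventually.of_forall fun p => hK p.1)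
  refine hconv.congr ?_
  filter_upwards [Measure.quasiMeasurePreserving_snd.ae (ae_restrict_mem measurableSet_ball)]
    with p hp
  by_cases h0 : k p.1 = 0
  · simp [h0]
  · rw [ContinuousLinearMap.mul_apply', Set.indicator_of_mem (hfar hp hζ),
      Set.indicator_of_mem (hfar (hkR h0) hp), map_inv₀, map_sub]
    congr 1
    rw [div_eq_mul_inv, mul_inv]
    ring

theorem statement11 (R : ℝ) (hR : 0 < R) (z0 lam ζ : ℂ) (hζ : ζ ∈ ball (0:ℂ) R)
    (φ : ℂ → ℂ) (hφ : ContDiff ℝ (⊤ : ℕ∞) φ) (hsupp : HasCompactSupport φ)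
    (hsub : tsupport φ ⊆ ball (0:ℂ) R) :
    ∫ z in ball (0:ℂ) R, Gker R z0 lam z ζ * lap φ z = φ ζ := by
  let h : ℂ → ℂ := fun z => exp (lam * (z - z0) ^ 2)
  have hh : Differentiable ℂ h := by fun_prop
  have hhc : Continuous h := hh.continuous
  have hhR : ContDiff ℝ 1 h := hh.contDiff.restrict_scalars ℝ
  have hh0 (z : ℂ) : h z ≠ 0 := exp_ne_zero _
  have hconj (z : ℂ) : exp ((starRingEnd ℂ) lam * (starRingEnd ℂ) (z - z0) ^ 2)
      = (starRingEnd ℂ) (h z) := by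
    simp [h, ← exp_conj]
  let E : ℂ → ℂ := fun η =>
    exp (-(lam * (η - z0) ^ 2) + (starRingEnd ℂ) lam * (starRingEnd ℂ) (η - z0) ^ 2)
  have hE (η : ℂ) : E η = (starRingEnd ℂ) (h η) / h η := by
    simp only [E]
    rw [exp_add, exp_neg, hconj, div_eq_inv_mul]
  have hEc : Continuous E := by
    have : Continuous (starRingEnd ℂ) := continuous_conj
    fun_prop
  have hφ1 : ContDiff ℝ 1 φ := contDiff_infty.1 hφ 1
  have hφ2 : ContDiff ℝ 2 φ := contDiff_infty.1 hφ 2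
  have hwz : ContDiff ℝ 1 (wz φ) := contDiff_wz (n := ⊤) (m := 1) hφ le_top
  have hwzc : HasCompactSupport (wz φ) := hsupp.mono' (support_wz_subset φ)
  let k : ℂ → ℂ := fun z => h z * lap φ z
  have hwbar (z : ℂ) : k z = 4 * wbar (fun w => h w * wz φ w) z := by
    simp only [k]
    rw [wbar_mul_of_differentiableAt (hh z) (hwz.differentiable one_ne_zero z),
      lap_eq_four_mul_wbar_wz hφ2]
    ring
  have hksupp : Function.support k ⊆ tsupport φ := fun z hz => by
    refine closure_minimal (support_wz_subset φ) (isClosed_tsupport φ)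
      (support_fderiv_subset ℝ (f := wz φ) fun h0 => hz ?_)
    simp [k, lap_eq_four_mul_wbar_wz hφ2, wbar, h0]
  have hkc : Continuous k := by
    have h1 : Continuous (fderiv ℝ (fun w => h w * wz φ w)) :=
      (hhR.mul hwz).continuous_fderiv one_ne_zero
    rw [show k = _ from funext hwbar]
    unfold wbar
    fun_prop
  have hint := integrable_mul_double_cauchy_kernel R hζ hEc hkc (hsupp.mono' hksupp)
    (hksupp.trans hsub)
  let c : ℂ := ((starRingEnd ℂ) (h ζ))⁻¹ / (4 * (Real.pi : ℂ) ^ 2)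
  have hG (z : ℂ) : Gker R z0 lam z ζ * lap φ z = c * ∫ η in ball (0 : ℂ) R,
      k z * (E η / ((z - η) * ((starRingEnd ℂ) η - (starRingEnd ℂ) ζ))) := by
    rw [integral_const_mul, Gker, gker, exp_sub, hconj, exp_neg]
    have := hh0 ζ
    change h z * (h ζ / _ / _ * _) * (h ζ)⁻¹ * lap φ z = c * (h z * lap φ z * _)
    simp only [c, E]
    field_simp
  have hinner (η : ℂ) :
      ∫ z, k z * (E η / ((z - η) * ((starRingEnd ℂ) η - (starRingEnd ℂ) ζ))) =
        -(4 * Real.pi) * (wz (fun w => (starRingEnd ℂ) (h w) * φ w) η /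
          ((starRingEnd ℂ) η - (starRingEnd ℂ) ζ)) := by
    calc _ = ∫ z, 4 * (E η / ((starRingEnd ℂ) η - (starRingEnd ℂ) ζ)) *
          (wbar (fun w => h w * wz φ w) z / (z - η)) := by
          refine integral_congr_ae (Eventually.of_forall fun z => ?_)
          simp only [hwbar, div_eq_mul_inv, mul_inv]
          ring
      _ = _ := by
          rw [integral_const_mul, cauchy_pompeiu (hhR.mul hwz) hwzc.mul_left, hE,
            wz_conj_mul_of_differentiableAt (hh η) (hφ1.differentiable one_ne_zero η)]
          have := hh0 η
          field_simp
  have hzero (z : ℂ) (hz : z ∉ ball (0 : ℂ) R) : Gker R z0 lam z ζ * lap φ z = 0 := by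
    have : k z = 0 := Function.notMem_support.1 fun h0 => hz (hsub (hksupp h0))
    rw [(mul_eq_zero.1 this).resolve_left (hh0 z), mul_zero]
  have hcφ : ContDiff ℝ 1 (fun w => (starRingEnd ℂ) (h w) * φ w) :=
    ((conjCLE : ℂ →L[ℝ] ℂ).contDiff.comp hhR).mul hφ1
  rw [setIntegral_eq_integral_of_forall_compl_eq_zero hzero]
  simp only [hG]
  rw [integral_const_mul, integral_integral_swap hint]
  simp only [hinner]
  rw [integral_const_mul, setIntegral_eq_integral_of_forall_compl_eq_zero,
    cauchy_pompeiu_conj hcφ hsupp.mul_left]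
  · have h1 : (starRingEnd ℂ) (h ζ) ≠ 0 := by simpa using hh0 ζ
    have h2 : (Real.pi : ℂ) ≠ 0 := by exact_mod_cast Real.pi_ne_zero
    simp only [c]
    field_simp
  · intro η hη
    rw [wz_conj_mul_of_differentiableAt (hh η) (hφ1.differentiable one_ne_zero η),
      Function.notMem_support.1 fun h0 => hη (hsub (support_wz_subset φ h0))]
    simp
end
end
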